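/- arXiv:1802.06098 — 2 statements merged into one kernel-verified Lean document; each statement's English description precedes it below -/
import Mathlib

section
/- Let (X,r) be a finite colored space with |X| ≥ 9 and 4 ≤ a_2(r) = a_3(r). Then the partition {E_α : α ∈ Im(r)} of the 2-subsets of X is of one of the following types: (i) there is a color α such that for every color β ≠ α the graph (X,E_β) is a matching, and the union of the E_β over all β ≠ α is also a matching; (ii) there are two distinct colors α,β and a partition of X into two nonempty sets Y and Z such that E_α consists of all 2-subsets contained in Y together with all 2-subsets contained in Z, for every color γ ∉ {α,β} the set E_γ is a matching consisting of edges between Y and Z, the union of the E_γ over all γ ∉ {α,β} is also a matching, and E_β consists of all remaining edges (all of which join Y to Z); (iii) a_2(r) = 4 and there are distinct elements y,z ∈ X and four distinct colors α,β,γ,δ with E_δ = {{y,z}}, E_γ = {{y,w} : w ∈ X\{y,z}}, E_β = {{z,w} : w ∈ X\{y,z}}, and E_α equal to the set of all 2-subsets of X\{y,z}. -/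
/-- The set of colors of the colored space `(X, r)`: values `r x y` for distinct `x, y`. -/
def colorIm {X C : Type*} (r : X → X → C) : Set C :=
  {α | ∃ x y : X, x ≠ y ∧ r x y = α}

/-- `a₂(r)`: the number of colors. -/
noncomputable def a2 {X C : Type*} (r : X → X → C) : ℕ := (colorIm r).ncard

/-- `A₃(r)`: the set of multisets of colors of triangles on 3-subsets of `X`. -/
def A3 {X C : Type*} (r : X → X → C) : Set (Multiset C) :=
  {m | ∃ x y z : X, x ≠ y ∧ y ≠ z ∧ x ≠ z ∧ m = {r x y, r y z, r x z}}

/-- `a₃(r)`: the number of isometry classes of 3-subsets. -/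
noncomputable def a3 {X C : Type*} (r : X → X → C) : ℕ := (A3 r).ncard

/-- `M_k(r)`: colors `α` such that the graph `(X, E_α)` has a vertex of degree at least `k`. -/
def Mdeg {X C : Type*} (r : X → X → C) (k : ℕ) : Set C :=
  {α | ∃ x : X, k ≤ {y | y ≠ x ∧ r x y = α}.ncard}

/-- A nonempty set `Γ` of colors is closed if `α, β ∈ Γ` and `αβγ ∈ A₃(r)` imply `γ ∈ Γ`. -/
def IsClosedColors {X C : Type*} (r : X → X → C) (Γ : Set C) : Prop :=
  ∀ α β γ : C, α ∈ Γ → β ∈ Γ → ({α, β, γ} : Multiset C) ∈ A3 r → γ ∈ Γ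

/-- The union of the color classes `E_α`, `α ∈ S`, is a matching (max degree ≤ 1). -/
def IsMatchingOn {X C : Type*} (r : X → X → C) (S : Set C) : Prop :=
  ∀ x y z : X, y ≠ x → z ≠ x → r x y ∈ S → r x z ∈ S → y = z

/-- `r₁` is a fusion of `r`: the color partition of `r` refines that of `r₁`. -/
def IsFusion {X C D : Type*} (r : X → X → C) (r₁ : X → X → D) : Prop :=
  ∀ x y u v : X, x ≠ y → u ≠ v → r x y = r u v → r₁ x y = r₁ u v

/-- The connected component of `x₀` in the graph on `X` whose edges are the pairs
colored by an element of `S`. -/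
def compOf {X C : Type*} (r : X → X → C) (S : Set C) (x₀ : X) : Set X :=
  {y | Relation.ReflTransGen (fun a b => a ≠ b ∧ r a b ∈ S) x₀ y}

/-- `A₃` of the subspace induced on `W ⊆ X`. -/
def A3on {X C : Type*} (r : X → X → C) (W : Set X) : Set (Multiset C) :=
  {m | ∃ x ∈ W, ∃ y ∈ W, ∃ z ∈ W, x ≠ y ∧ y ≠ z ∧ x ≠ z ∧ m = {r x y, r y z, r x z}}

/-- Type (i) of Theorem 1.2: there is a color `α` such that every other color class is a
matching and the union of all color classes other than `E_α` is also a matching. -/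
def PartitionTypeI {X C : Type*} (r : X → X → C) : Prop :=
  ∃ α ∈ colorIm r,
    (∀ β ∈ colorIm r, β ≠ α → IsMatchingOn r {β}) ∧
      IsMatchingOn r (colorIm r \ {α})

/-- Type (ii) of Theorem 1.2: a disjoint union of two cliques (color `α`), disjoint
matchings between the two cliques, and the remaining edges between them (color `β`). -/
def PartitionTypeII {X C : Type*} (r : X → X → C) : Prop :=
  ∃ α ∈ colorIm r, ∃ β ∈ colorIm r, α ≠ β ∧
    ∃ Y Z : Set X, Y.Nonempty ∧ Z.Nonempty ∧ Disjoint Y Z ∧ Y ∪ Z = Set.univ ∧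
      (∀ x y : X, x ≠ y → (r x y = α ↔ (x ∈ Y ∧ y ∈ Y) ∨ (x ∈ Z ∧ y ∈ Z))) ∧
      (∀ γ ∈ colorIm r, γ ≠ α → γ ≠ β →
        (∀ x y : X, x ≠ y → r x y = γ → (x ∈ Y ∧ y ∈ Z) ∨ (x ∈ Z ∧ y ∈ Y)) ∧
          IsMatchingOn r {γ}) ∧
      IsMatchingOn r (colorIm r \ {α, β}) ∧
      (∀ x y : X, x ≠ y → r x y = β → (x ∈ Y ∧ y ∈ Z) ∨ (x ∈ Z ∧ y ∈ Y))

/-- Type (iii) of Theorem 1.2: one edge `{y, z}` (color `δ`), the edges from `y` (color `γ`),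
the edges from `z` (color `β`), and the remaining edges (color `α`). -/
def PartitionTypeIII {X C : Type*} (r : X → X → C) : Prop :=
  ∃ y z : X, y ≠ z ∧ ∃ α β γ δ : C,
    (α ≠ β ∧ α ≠ γ ∧ α ≠ δ ∧ β ≠ γ ∧ β ≠ δ ∧ γ ≠ δ) ∧
    r y z = δ ∧
    (∀ w : X, w ≠ y → w ≠ z → r y w = γ) ∧
    (∀ w : X, w ≠ y → w ≠ z → r z w = β) ∧
    (∀ u v : X, u ≠ v → u ≠ y → u ≠ z → v ≠ y → v ≠ z → r u v = α)


theorem T3_eq {C : Type*} (a b c d e f : C) :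
    (({a, b, c} : Multiset C) = {d, e, f}) ↔
      (a = d ∧ b = e ∧ c = f) ∨ (a = d ∧ b = f ∧ c = e) ∨ (a = e ∧ b = d ∧ c = f) ∨
      (a = e ∧ b = f ∧ c = d) ∨ (a = f ∧ b = d ∧ c = e) ∨ (a = f ∧ b = e ∧ c = d) := by
  classical
  constructor
  · intro h
    have hc : ∀ x : C, Multiset.count x ({a, b, c} : Multiset C) = Multiset.count x {d, e, f} := by
      intro x; rw [h]
    simp only [Multiset.insert_eq_cons, Multiset.count_cons, Multiset.count_singleton] at hc
    have h1 := hc a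
    have h2 := hc b
    have h3 := hc c
    clear hc h
    grind
  · have p1 : ∀ x y z : C, ({x, y, z} : Multiset C) = {x, z, y} := by
      intro x y z
      simp only [Multiset.insert_eq_cons]
      rw [← Multiset.cons_zero, ← Multiset.cons_zero, Multiset.cons_swap y z]
    have p2 : ∀ x y z : C, ({x, y, z} : Multiset C) = {y, x, z} := by
      intro x y z
      simp only [Multiset.insert_eq_cons]
      rw [Multiset.cons_swap]
    rintro (⟨rfl, rfl, rfl⟩ | ⟨rfl, rfl, rfl⟩ | ⟨rfl, rfl, rfl⟩ | ⟨rfl, rfl, rfl⟩ |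
      ⟨rfl, rfl, rfl⟩ | ⟨rfl, rfl, rfl⟩)
    · rfl
    · rw [p1]
    · rw [p2]
    · rw [p1, p2]
    · rw [p2, p1]
    · rw [p1, p2, p1]

theorem ex_out {X : Type*} [Fintype X] (s : Finset X) (h : s.card < Fintype.card X) :
    ∃ x, x ∉ s := by
  by_contra hh
  push Not at hh
  have : s = Finset.univ := by ext; simp [hh]
  rw [this, Finset.card_univ] at h
  exact lt_irrefl _ h

theorem ex_three {X : Type*} [Fintype X] (hX : 9 ≤ Fintype.card X) (a b : X) :
    ∃ c d e : X, c ≠ a ∧ c ≠ b ∧ d ≠ a ∧ d ≠ b ∧ e ≠ a ∧ e ≠ b ∧ c ≠ d ∧ c ≠ e ∧ d ≠ e := by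
  classical
  obtain ⟨c, hc⟩ := ex_out ({a, b} : Finset X) (lt_of_le_of_lt Finset.card_le_two (by omega))
  obtain ⟨d, hd⟩ := ex_out ({a, b, c} : Finset X) (lt_of_le_of_lt Finset.card_le_three (by omega))
  obtain ⟨e, he⟩ := ex_out ({a, b, c, d} : Finset X) (lt_of_le_of_lt Finset.card_le_four (by omega))
  simp only [Finset.mem_insert, Finset.mem_singleton, not_or] at hc hd he
  exact ⟨c, d, e, by tauto, by tauto, by tauto, by tauto, by tauto, by tauto, by tauto, by tauto,
    by tauto⟩

/-- The incidence map from colour functions to triangle-type functions. -/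
noncomputable def incMap {X C : Type*} (r : X → X → C) :
    (C → ℚ) →ₗ[ℚ] (A3 r → ℚ) where
  toFun f m := (m.1.map f).sum
  map_add' f g := by
    ext m
    simp [Multiset.sum_map_add]
  map_smul' c f := by
    ext m
    simp [Multiset.sum_map_mul_left]

theorem zero_of_tri {X C : Type*} [Fintype X] (r : X → X → C)
    (hsym : ∀ x y, r x y = r y x) (hX : 9 ≤ Fintype.card X) (f : C → ℚ)
    (hf : ∀ x y z, x ≠ y → y ≠ z → x ≠ z → f (r x y) + f (r y z) + f (r x z) = 0) :
    ∀ x y, x ≠ y → f (r x y) = 0 := by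
  intro a b hab
  obtain ⟨c, d, e, h1, h2, h3, h4, h5, h6, h7, h8, h9⟩ := ex_three hX a b
  have e1 := hf a b c hab h2.symm h1.symm
  have e2 := hf a b d hab h4.symm h3.symm
  have e3 := hf a b e hab h6.symm h5.symm
  have e4 := hf a c d h1.symm h7 h3.symm
  have e5 := hf a c e h1.symm h8 h5.symm
  have e6 := hf a d e h3.symm h9 h5.symm
  have e7 := hf b c d h2.symm h7 h4.symm
  have e8 := hf b c e h2.symm h8 h6.symm
  have e9 := hf b d e h4.symm h9 h6.symm
  have e10 := hf c d e h7 h9 h8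
  linarith

theorem finite_colorIm {X C : Type*} [Fintype X] (r : X → X → C) : (colorIm r).Finite := by
  apply (Set.finite_range (fun p : X × X => r p.1 p.2)).subset
  rintro c ⟨x, y, _, rfl⟩
  exact ⟨(x, y), rfl⟩

theorem finite_A3 {X C : Type*} [Fintype X] (r : X → X → C) : (A3 r).Finite := by
  apply (Set.finite_range
    (fun p : X × X × X => ({r p.1 p.2.1, r p.2.1 p.2.2, r p.1 p.2.2} : Multiset C))).subset
  rintro c ⟨x, y, z, _, _, _, rfl⟩
  exact ⟨(x, y, z), rfl⟩

theorem exists_dual {X C : Type*} [Fintype X] (r : X → X → C)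
    (hsym : ∀ x y, r x y = r y x) (hX : 9 ≤ Fintype.card X) (h23 : a2 r = a3 r)
    (s : Multiset C → ℚ) : ∃ f : C → ℚ, ∀ x y z, x ≠ y → y ≠ z → x ≠ z →
      f (r x y) + f (r y z) + f (r x z) = s {r x y, r y z, r x z} := by
  classical
  have := (finite_colorIm r).fintype
  have := (finite_A3 r).fintype
  let E : (colorIm r → ℚ) →ₗ[ℚ] (C → ℚ) :=
    Function.ExtendByZero.linearMap ℚ (Subtype.val : colorIm r → C)
  let L := (incMap r).comp E
  have hL : ∀ (f : colorIm r → ℚ) x y z (h1 : x ≠ y) (h2 : y ≠ z) (h3 : x ≠ z),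
      L f ⟨{r x y, r y z, r x z}, x, y, z, h1, h2, h3, rfl⟩
        = E f (r x y) + E f (r y z) + E f (r x z) := by
    intro f x y z h1 h2 h3
    simp [L, incMap, add_assoc]
  have hE : ∀ (f : colorIm r → ℚ) (c : colorIm r), E f c.1 = f c := by
    intro f c
    simp only [E, Function.ExtendByZero.linearMap_apply]
    exact Subtype.val_injective.extend_apply f 0 c
  have inj : Function.Injective L := by
    rw [← LinearMap.ker_eq_bot, LinearMap.ker_eq_bot']
    intro f hf
    have hz := zero_of_tri r hsym hX (E f) (by
      intro x y z h1 h2 h3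
      rw [← hL f x y z h1 h2 h3, hf]; rfl)
    ext ⟨c, x, y, hxy, rfl⟩
    rw [← hE f, hz x y hxy]; rfl
  have hfr : Module.finrank ℚ (colorIm r → ℚ) = Module.finrank ℚ (A3 r → ℚ) := by
    rw [Module.finrank_fintype_fun_eq_card, Module.finrank_fintype_fun_eq_card,
      ← Nat.card_eq_fintype_card, ← Nat.card_eq_fintype_card]
    exact h23
  have surj := (LinearMap.injective_iff_surjective_of_finrank_eq_finrank hfr).1 inj
  obtain ⟨f, hf⟩ := surj (fun m => s m.1)
  refine ⟨E f, fun x y z h1 h2 h3 => ?_⟩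
  rw [← hL f x y z h1 h2 h3, hf]

theorem tri_alpha {C : Type*} (a b c d α : C) :
    (({a, b, α} : Multiset C) = {c, d, α}) ↔ (a = c ∧ b = d) ∨ (a = d ∧ b = c) := by
  rw [T3_eq]; grind

/-- four colours from an outside vertex to a clique -/
theorem no_three {C : Type*} [DecidableEq C] (V : Multiset C → C → ℚ) (α p q s d : C)
    (hα : ∀ t, t ≠ ({α, α, α} : Multiset C) → V t α = 0)
    (h : ∀ t, t ≠ ({α, α, α} : Multiset C) →
      V t p + V t q = (if ({p, q, α} : Multiset C) = t then 1 else 0) ∧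
      V t p + V t s = (if ({p, s, α} : Multiset C) = t then 1 else 0) ∧
      V t p + V t d = (if ({p, d, α} : Multiset C) = t then 1 else 0) ∧
      V t q + V t s = (if ({q, s, α} : Multiset C) = t then 1 else 0) ∧
      V t q + V t d = (if ({q, d, α} : Multiset C) = t then 1 else 0) ∧
      V t s + V t d = (if ({s, d, α} : Multiset C) = t then 1 else 0))
    (hpq : p ≠ q) (hps : p ≠ s) (hqs : q ≠ s) : False := by
  have hne : ({p, q, α} : Multiset C) ≠ {α, α, α} := by
    rw [Ne, T3_eq]; grind
  obtain ⟨h1, h2, h3, h4, h5, h6⟩ := h _ hne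
  simp only [tri_alpha] at h1 h2 h3 h4 h5 h6
  clear h hα hne
  split_ifs at * <;> first | linarith | grind

theorem no_two_two {C : Type*} [DecidableEq C] (V : Multiset C → C → ℚ) (α p q : C)
    (h : ∀ t, t ≠ ({α, α, α} : Multiset C) →
      V t p + V t q = (if ({p, q, α} : Multiset C) = t then 1 else 0) ∧
      V t p + V t p = (if ({p, p, α} : Multiset C) = t then 1 else 0) ∧
      V t q + V t q = (if ({q, q, α} : Multiset C) = t then 1 else 0))
    (hpq : p ≠ q) : False := by
  have hne : ({p, q, α} : Multiset C) ≠ {α, α, α} := by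
    rw [Ne, T3_eq]; grind
  obtain ⟨h1, h2, h3⟩ := h _ hne
  simp only [tri_alpha] at h1 h2 h3
  clear h hne
  split_ifs at * <;> first | linarith | grind

theorem ex_diff {X : Type*} [DecidableEq X] (Q : Finset X) (s : Finset X) (h : s.card < Q.card) :
    ∃ x ∈ Q, x ∉ s := by
  exact Finset.exists_mem_notMem_of_card_lt_card h

theorem main_color {X C : Type*} [DecidableEq X] [DecidableEq C] (r : X → X → C)
    (hsym : ∀ x y, r x y = r y x)
    (V : Multiset C → C → ℚ)
    (hV : ∀ t x y z, x ≠ y → y ≠ z → x ≠ z → V t (r x y) + V t (r y z) + V t (r x z) =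
      if ({r x y, r y z, r x z} : Multiset C) = t then 1 else 0)
    (α : C) (Q : Finset X) (hQ4 : 4 ≤ Q.card)
    (hQ : ∀ a ∈ Q, ∀ b ∈ Q, a ≠ b → r a b = α)
    (hα : ∀ t, t ≠ ({α, α, α} : Multiset C) → V t α = 0)
    (x : X) (hx : x ∉ Q) : ∃ a ∈ Q, ∃ p, ∀ b ∈ Q, b ≠ a → r x b = p := by
  have key : ∀ t, t ≠ ({α, α, α} : Multiset C) → ∀ a ∈ Q, ∀ b ∈ Q, a ≠ b →
      V t (r x a) + V t (r x b) =
        if ({r x a, r x b, α} : Multiset C) = t then 1 else 0 := by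
    intro t ht a ha b hb hab
    have h := hV t a x b (fun h => hx (h ▸ ha)) (fun h => hx (h ▸ hb)) hab
    rw [hQ a ha b hb hab, hα t ht, hsym a x] at h
    linarith
  by_cases hall : ∀ a ∈ Q, ∀ b ∈ Q, r x a = r x b
  · obtain ⟨a, ha⟩ : Q.Nonempty := Finset.card_pos.1 (by omega)
    exact ⟨a, ha, r x a, fun b hb _ => hall b hb a ha⟩
  push Not at hall
  obtain ⟨a, ha, b, hb, hab⟩ := hall
  have hne : a ≠ b := fun h => hab (h ▸ rfl)
  have h2 : ∀ c ∈ Q, c ≠ a → c ≠ b → r x c = r x a ∨ r x c = r x b := by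
    intro c hc hca hcb
    by_contra hcon
    push Not at hcon
    obtain ⟨d, hd, hd'⟩ := ex_diff Q {a, b, c} (lt_of_le_of_lt Finset.card_le_three (by omega))
    simp only [Finset.mem_insert, Finset.mem_singleton, not_or] at hd'
    exact no_three V α (r x a) (r x b) (r x c) (r x d) hα
      (fun t ht => ⟨key t ht a ha b hb hne, key t ht a ha c hc hca.symm,
        key t ht a ha d hd (Ne.symm hd'.1), key t ht b hb c hc hcb.symm,
        key t ht b hb d hd (Ne.symm hd'.2.1), key t ht c hc d hd (Ne.symm hd'.2.2)⟩)
      hab hcon.1.symm hcon.2.symm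
  have h3 : ∀ c ∈ Q, ∀ d ∈ Q, c ≠ a → c ≠ b → d ≠ a → d ≠ b → r x c = r x a → r x d = r x b →
      False := by
    intro c hc d hd hca hcb hda hdb hc' hd'
    refine no_two_two V α (r x a) (r x b) (fun t ht => ⟨key t ht a ha b hb hne, ?_, ?_⟩) hab
    · have := key t ht a ha c hc hca.symm
      rwa [hc'] at this
    · have := key t ht b hb d hd hdb.symm
      rwa [hd'] at this
  by_cases h4 : ∃ c ∈ Q, c ≠ a ∧ c ≠ b ∧ r x c = r x a
  · obtain ⟨c, hc, hca, hcb, hc'⟩ := h4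
    refine ⟨b, hb, r x a, fun d hd hdb => ?_⟩
    by_cases hda : d = a
    · rw [hda]
    rcases h2 d hd hda hdb with h | h
    · exact h
    · exact (h3 c hc d hd hca hcb hda hdb hc' h).elim
  · push Not at h4
    refine ⟨a, ha, r x b, fun d hd hda => ?_⟩
    by_cases hdb : d = b
    · rw [hdb]
    rcases h2 d hd hda hdb with h | h
    · exact (h4 d hd hda hdb h).elim
    · exact h

set_option maxHeartbeats 4000000 in
theorem classify_of_clique {X C : Type*} [Fintype X] [DecidableEq X] [DecidableEq C]
    (r : X → X → C) (hsym : ∀ x y, r x y = r y x) (h4 : 4 ≤ a2 r)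
    (V : Multiset C → C → ℚ)
    (hV : ∀ t x y z, x ≠ y → y ≠ z → x ≠ z → V t (r x y) + V t (r y z) + V t (r x z) =
      if ({r x y, r y z, r x z} : Multiset C) = t then 1 else 0)
    (α : C) (Q : Finset X) (hQ4 : 4 ≤ Q.card)
    (hQ : ∀ a ∈ Q, ∀ b ∈ Q, a ≠ b → r a b = α)
    (hmax : ∀ x, x ∉ Q → ∃ a ∈ Q, r x a ≠ α) :
    PartitionTypeI r ∨ PartitionTypeII r ∨ (a2 r = 4 ∧ PartitionTypeIII r) := by
  have card_le : ∀ s : Finset C, (∀ x y, x ≠ y → r x y ∈ s) → a2 r ≤ s.card := by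
    intro s hs
    unfold a2
    rw [← Set.ncard_coe_finset s]
    apply Set.ncard_le_ncard _ s.finite_toSet
    rintro c ⟨x, y, hxy, rfl⟩
    exact hs x y hxy
  obtain ⟨u, hu, u', hu', huu⟩ : ∃ u ∈ Q, ∃ u' ∈ Q, u ≠ u' :=
    Finset.one_lt_card.1 (by omega)
  have hαim : α ∈ colorIm r := ⟨u, u', huu, hQ u hu u' hu' huu⟩
  have hα : ∀ t, t ≠ ({α, α, α} : Multiset C) → V t α = 0 := by
    intro t ht
    obtain ⟨w, hw, hw'⟩ := ex_diff Q {u, u'} (lt_of_le_of_lt Finset.card_le_two (by omega))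
    simp only [Finset.mem_insert, Finset.mem_singleton, not_or] at hw'
    have := hV t u u' w huu (Ne.symm hw'.2) (Ne.symm hw'.1)
    rw [hQ u hu u' hu' huu, hQ u' hu' w hw (Ne.symm hw'.2), hQ u hu w hw (Ne.symm hw'.1),
      if_neg ht.symm] at this
    linarith
  have hm := main_color r hsym V hV α Q hQ4 hQ hα
  have : Nonempty C := ⟨α⟩
  choose! a haQ p hp using hm
  -- values of V on the main colour and on the exceptional colour
  have vp : ∀ x, x ∉ Q → ∀ t, t ≠ ({α, α, α} : Multiset C) →
      V t (p x) = (if ({p x, p x, α} : Multiset C) = t then 1 else 0) / 2 := by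
    intro x hx t ht
    obtain ⟨b, hb, hb'⟩ := ex_diff Q {a x} (by rw [Finset.card_singleton]; omega)
    obtain ⟨c, hc, hc'⟩ := ex_diff Q {a x, b} (lt_of_le_of_lt Finset.card_le_two (by omega))
    simp only [Finset.mem_insert, Finset.mem_singleton, not_or] at hb' hc'
    have h := hV t b x c (fun h => hx (h ▸ hb)) (fun h => hx (h ▸ hc)) (Ne.symm hc'.2)
    rw [hQ b hb c hc (Ne.symm hc'.2), hα t ht, hsym b x, hp x hx b hb hb',
      hp x hx c hc hc'.1] at h
    linarith
  have vq : ∀ x, x ∉ Q → ∀ t, t ≠ ({α, α, α} : Multiset C) →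
      V t (r x (a x)) = (if ({r x (a x), p x, α} : Multiset C) = t then 1 else 0)
        - (if ({p x, p x, α} : Multiset C) = t then 1 else 0) / 2 := by
    intro x hx t ht
    obtain ⟨c, hc, hc'⟩ := ex_diff Q {a x} (by rw [Finset.card_singleton]; omega)
    simp only [Finset.mem_singleton] at hc'
    have hb := haQ x hx
    have h := hV t (a x) x c (fun h => hx (h ▸ hb)) (fun h => hx (h ▸ hc)) (Ne.symm hc')
    rw [hQ _ hb c hc (Ne.symm hc'), hα t ht, hsym (a x) x,
      hp x hx c hc hc', vp x hx t ht] at h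
    linarith
  have qne : ∀ x, x ∉ Q → r x (a x) ≠ α := by
    intro x hx hq
    by_cases hpα : p x = α
    · obtain ⟨b, hb, hb'⟩ := hmax x hx
      by_cases hba : b = a x
      · exact hb' (hba ▸ hq)
      · exact hb' ((hp x hx b hb hba).trans hpα)
    · have ht : ({p x, p x, α} : Multiset C) ≠ {α, α, α} := by rw [Ne, T3_eq]; grind
      have h := vq x hx _ ht
      rw [hq, hα _ ht, if_pos rfl, if_neg (by rw [T3_eq]; grind)] at h
      linarith
  have ve : ∀ x, x ∉ Q → ∀ y, y ∉ Q → x ≠ y → ∀ t, t ≠ ({α, α, α} : Multiset C) →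
      V t (r x y) = (if ({r x y, p x, p y} : Multiset C) = t then 1 else 0)
        - (if ({p x, p x, α} : Multiset C) = t then 1 else 0) / 2
        - (if ({p y, p y, α} : Multiset C) = t then 1 else 0) / 2 := by
    intro x hx y hy hxy t ht
    obtain ⟨c, hc, hc'⟩ := ex_diff Q {a x, a y} (lt_of_le_of_lt Finset.card_le_two (by omega))
    simp only [Finset.mem_insert, Finset.mem_singleton, not_or] at hc'
    have h := hV t x y c hxy (fun h => hy (h ▸ hc)) (fun h => hx (h ▸ hc))
    rw [hp x hx c hc hc'.1, hp y hy c hc hc'.2, vp x hx t ht, vp y hy t ht] at h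
    have hT : ({r x y, p y, p x} : Multiset C) = {r x y, p x, p y} := by rw [T3_eq]; tauto
    rw [hT] at h
    linarith
  have hE : ∀ x, x ∉ Q → ∀ y, y ∉ Q → x ≠ y → ∀ c ∈ Q, ∀ t,
      V t (r x y) + V t (r y c) + V t (r x c) =
        if ({r x y, r y c, r x c} : Multiset C) = t then 1 else 0 := by
    intro x hx y hy hxy c hc t
    exact hV t x y c hxy (fun h => hy (h ▸ hc)) (fun h => hx (h ▸ hc))
  have tne : ∀ q, q ≠ α → ({q, α, α} : Multiset C) ≠ {α, α, α} := by
    intro q hq; rw [Ne, T3_eq]; grind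
  have tne2 : ∀ q, q ≠ α → ({q, q, α} : Multiset C) ≠ {α, α, α} := by
    intro q hq; rw [Ne, T3_eq]; grind
  by_cases hcase : ∀ x, x ∉ Q → p x = α
  · -- type (i)
    left
    have hZ1 : ∀ x, x ∉ Q → ∀ y, y ∉ Q → x ≠ y → a x ≠ a y := by
      intro x hx y hy hxy hxa
      have h := hE x hx y hy hxy (a x) (haQ x hx) {r x (a x), α, α}
      have t1 := tne _ (qne x hx)
      have q2 := vq y hy _ t1
      have n1 := qne x hx
      have n2 := qne y hy
      rw [← hxa] at n2 q2
      rw [vq x hx _ t1, ve x hx y hy hxy _ t1, q2, hcase x hx, hcase y hy] at h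
      simp only [T3_eq] at h
      split_ifs at h <;> first | linarith | grind
    have hZ2 : ∀ x, x ∉ Q → ∀ y, y ∉ Q → x ≠ y → r x y = α := by
      intro x hx y hy hxy
      by_contra hne
      have h := hE x hx y hy hxy (a x) (haQ x hx) {r x y, α, α}
      have t1 := tne _ hne
      have n1 := qne x hx
      rw [vq x hx _ t1, ve x hx y hy hxy _ t1, hp y hy (a x) (haQ x hx) (hZ1 x hx y hy hxy),
        hcase x hx, hcase y hy, hα _ t1] at h
      simp only [T3_eq] at h
      split_ifs at h <;> first | linarith | grind
    have hmat : IsMatchingOn r (colorIm r \ {α}) := by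
      intro x y z hy hz hxy hxz
      have hxy := hxy.2
      have hxz := hxz.2
      simp only [Set.mem_singleton_iff] at hxy hxz
      have out : ∀ x, x ∉ Q → ∀ y, y ≠ x → r x y ≠ α → y ∈ Q ∧ y = a x := by
        intro x hx y hy h
        by_cases hyQ : y ∈ Q
        · refine ⟨hyQ, ?_⟩
          by_contra hya
          exact h ((hp x hx y hyQ hya).trans (hcase x hx))
        · exact (h (hZ2 x hx y hyQ hy.symm)).elim
      by_cases hx : x ∈ Q
      · have hyQ : y ∉ Q := fun h => hxy (hQ x hx y h hy.symm)
        have hzQ : z ∉ Q := fun h => hxz (hQ x hx z h hz.symm)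
        have e1 := (out y hyQ x hy.symm (by rwa [hsym])).2
        have e2 := (out z hzQ x hz.symm (by rwa [hsym])).2
        by_contra hyz
        exact hZ1 y hyQ z hzQ hyz (e1.symm.trans e2)
      · exact (out x hx y hy hxy).2.trans (out x hx z hz hxz).2.symm
    refine ⟨α, hαim, ?_, hmat⟩
    intro β hβ hβα x y z hy hz hxy hxz
    have hxy : r x y = β := hxy
    have hxz : r x z = β := hxz
    exact hmat x y z hy hz (by rw [hxy]; exact ⟨hβ, hβα⟩) (by rw [hxz]; exact ⟨hβ, hβα⟩)
  right
  push Not at hcase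
  obtain ⟨x₀, hx₀, hpx₀⟩ := hcase
  have hpne : ∀ x, x ∉ Q → p x ≠ α := by
    intro x hx hpx
    have hxy : x ≠ x₀ := fun h => hpx₀ (h ▸ hpx)
    have n1 := qne x hx
    have n2 := qne x₀ hx₀
    have hne : r x x₀ ≠ α := by
      intro he
      have h := ve x hx x₀ hx₀ hxy _ (tne _ hpx₀)
      rw [he, hpx, hα _ (tne _ hpx₀)] at h
      simp only [T3_eq] at h
      split_ifs at h <;> first | linarith | grind
    have t1 := tne _ n1
    have h := hE x hx x₀ hx₀ hxy (a x) (haQ x hx) {r x (a x), α, α}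
    by_cases haa : a x = a x₀
    · have q2 := vq x₀ hx₀ _ t1
      rw [← haa] at n2 q2
      rw [vq x hx _ t1, ve x hx x₀ hx₀ hxy _ t1, q2, hpx] at h
      simp only [T3_eq] at h
      split_ifs at h <;> first | linarith | grind
    · rw [vq x hx _ t1, ve x hx x₀ hx₀ hxy _ t1, hp x₀ hx₀ (a x) (haQ x hx) haa,
        vp x₀ hx₀ _ t1, hpx] at h
      simp only [T3_eq] at h
      split_ifs at h <;> first | linarith | grind
  have hepp : ∀ x, x ∉ Q → ∀ y, y ∉ Q → x ≠ y → r x y = α → p x = p y := by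
    intro x hx y hy hxy he
    have h := ve x hx y hy hxy _ (tne2 _ (hpne x hx))
    rw [he, hα _ (tne2 _ (hpne x hx))] at h
    have n1 := hpne x hx
    have n2 := hpne y hy
    simp only [T3_eq] at h
    split_ifs at h <;> first | linarith | grind
  have hebad : ∀ x, x ∉ Q → ∀ y, y ∉ Q → x ≠ y → r x y ≠ α →
      V {p x, p x, α} (r x y) ≤ -1/2 := by
    intro x hx y hy hxy he
    rw [ve x hx y hy hxy _ (tne2 _ (hpne x hx))]
    have n1 := hpne x hx
    have n2 := hpne y hy
    simp only [T3_eq]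
    split_ifs <;> first | linarith | grind
  have hele : ∀ x, x ∉ Q → ∀ y, y ∉ Q → x ≠ y → ∀ s, s ≠ α →
      V {s, s, α} (r x y) ≤ 0 := by
    intro x hx y hy hxy s hs
    rw [ve x hx y hy hxy _ (tne2 _ hs)]
    have n1 := hpne x hx
    have n2 := hpne y hy
    simp only [T3_eq]
    split_ifs <;> first | linarith | grind
  by_cases hclq : ∀ x, x ∉ Q → ∀ y, y ∉ Q → x ≠ y → r x y = α
  · -- type (ii)
    left
    have hpp : ∀ x, x ∉ Q → p x = p x₀ := by
      intro x hx
      by_cases h : x = x₀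
      · rw [h]
      · exact hepp x hx x₀ hx₀ h (hclq x hx x₀ hx₀ h)
    have hcr : ∀ x, x ∉ Q → ∀ y ∈ Q, r x y ≠ α := by
      intro x hx y hy
      by_cases h : y = a x
      · rw [h]; exact qne x hx
      · rw [hp x hx y hy h]; exact hpne x hx
    have hZ1 : ∀ x, x ∉ Q → ∀ y, y ∉ Q → x ≠ y → r x (a x) ≠ p x₀ → r y (a y) ≠ p x₀ →
        a x ≠ a y := by
      intro x hx y hy hxy n1 n2 haa
      have t1 := tne2 _ hpx₀
      have h := hE x hx y hy hxy (a x) (haQ x hx) {p x₀, p x₀, α}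
      have q2 := vq y hy _ t1
      rw [← haa] at q2 n2
      have m1 := hcr x hx (a x) (haQ x hx)
      have m2 := hcr y hy (a x) (haQ x hx)
      rw [vq x hx _ t1, q2, hpp x hx, hpp y hy, hclq x hx y hy hxy, hα _ t1] at h
      simp only [T3_eq] at h
      split_ifs at h <;> first | linarith | grind
    have out : ∀ x, x ∉ Q → ∀ y, y ≠ x → r x y ≠ α → r x y ≠ p x₀ →
        y ∈ Q ∧ y = a x := by
      intro x hx y hy h h'
      by_cases hyQ : y ∈ Q
      · refine ⟨hyQ, ?_⟩
        by_contra hya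
        exact h' ((hp x hx y hyQ hya).trans (hpp x hx))
      · exact (h (hclq x hx y hyQ hy.symm)).elim
    have hmat : IsMatchingOn r (colorIm r \ {α, p x₀}) := by
      intro x y z hy hz hxy hxz
      have hxy := hxy.2
      have hxz := hxz.2
      simp only [Set.mem_insert_iff, Set.mem_singleton_iff, not_or] at hxy hxz
      by_cases hx : x ∈ Q
      · have hyQ : y ∉ Q := fun h => hxy.1 (hQ x hx y h hy.symm)
        have hzQ : z ∉ Q := fun h => hxz.1 (hQ x hx z h hz.symm)
        rw [hsym x y] at hxy
        rw [hsym x z] at hxz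
        have e1 := (out y hyQ x hy.symm hxy.1 hxy.2).2
        have e2 := (out z hzQ x hz.symm hxz.1 hxz.2).2
        by_contra hyz
        exact hZ1 y hyQ z hzQ hyz (by rw [← e1]; exact hxy.2) (by rw [← e2]; exact hxz.2)
          (e1.symm.trans e2)
      · exact (out x hx y hy hxy.1 hxy.2).2.trans (out x hx z hz hxz.1 hxz.2).2.symm
    have hside : ∀ x y, x ≠ y →
        (r x y = α ↔ (x ∈ (Q : Set X) ∧ y ∈ (Q : Set X)) ∨
          (x ∈ (Q : Set X)ᶜ ∧ y ∈ (Q : Set X)ᶜ)) := by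
      intro x y hxy
      simp only [Finset.mem_coe, Set.mem_compl_iff]
      by_cases hx : x ∈ Q <;> by_cases hy : y ∈ Q <;> simp only [hx, hy]
      · simp [hQ x hx y hy hxy]
      · have := hcr y hy x hx
        rw [hsym] at this
        simp [this]
      · simp [hcr x hx y hy]
      · simp [hclq x hx y hy hxy]
    have hcross : ∀ x y, x ≠ y → r x y ≠ α → (x ∈ (Q : Set X) ∧ y ∈ (Q : Set X)ᶜ) ∨
          (x ∈ (Q : Set X)ᶜ ∧ y ∈ (Q : Set X)) := by
      intro x y hxy h
      have := hside x y hxy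
      simp only [Finset.mem_coe, Set.mem_compl_iff] at this ⊢
      tauto
    obtain ⟨b, hb, hb'⟩ := ex_diff Q {a x₀} (by rw [Finset.card_singleton]; omega)
    simp only [Finset.mem_singleton] at hb'
    refine ⟨α, hαim, p x₀, ⟨x₀, b, fun h => hx₀ (h ▸ hb), hp x₀ hx₀ b hb hb'⟩, hpx₀.symm,
      (Q : Set X), (Q : Set X)ᶜ, ⟨u, hu⟩, ⟨x₀, by simpa using hx₀⟩, disjoint_compl_right,
      Set.union_compl_self _, hside, ?_, hmat, ?_⟩
    · intro γ hγ h1 h2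
      refine ⟨fun x y hxy h => hcross x y hxy (h ▸ h1), ?_⟩
      intro x y z hy hz hxy hxz
      have hxy : r x y = γ := hxy
      have hxz : r x z = γ := hxz
      have hm : γ ∈ colorIm r \ {α, p x₀} := ⟨hγ, by simp [h1, h2]⟩
      exact hmat x y z hy hz (by rw [hxy]; exact hm) (by rw [hxz]; exact hm)
    · intro x y hxy h
      exact hcross x y hxy (by rw [h]; exact hpx₀)
  · push Not at hclq
    obtain ⟨x, hx, y, hy, hxy, he⟩ := hclq
    have hnn : ∀ t x y z, x ≠ y → y ≠ z → x ≠ z →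
        0 ≤ V t (r x y) + V t (r y z) + V t (r x z) := by
      intro t x y z h1 h2 h3
      rw [hV t x y z h1 h2 h3]
      split_ifs <;> norm_num
    have hZ : ∀ z, z ∉ Q → z = x ∨ z = y := by
      intro z hz
      by_contra hcon
      push Not at hcon
      have h := hnn {p x, p x, α} x y z hxy hcon.2.symm hcon.1.symm
      have h1 := hebad x hx y hy hxy he
      have h2 := hele y hy z hz hcon.2.symm (p x) (hpne x hx)
      have h3 := hele x hx z hz hcon.1.symm (p x) (hpne x hx)
      linarith
    have hexc : ∀ x, x ∉ Q → ∀ y, y ∉ Q → x ≠ y → r x y ≠ α → ∀ c ∈ Q, r x c = p x := by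
      intro x hx y hy hxy he c hc
      by_cases hca : c = a x
      swap
      · exact hp x hx c hc hca
      by_contra hne
      have t1 := tne2 _ (hpne x hx)
      have h := hnn {p x, p x, α} x y c hxy (fun h => hy (h ▸ hc)) (fun h => hx (h ▸ hc))
      have h1 := hebad x hx y hy hxy he
      have n1 := qne x hx
      have n2 := hpne x hx
      have h2 : V {p x, p x, α} (r x c) ≤ -1/2 := by
        rw [hca] at hne ⊢
        rw [vq x hx _ t1]
        simp only [T3_eq]
        split_ifs <;> first | linarith | grind
      have h3 : V {p x, p x, α} (r y c) ≤ 1/2 := by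
        by_cases hcy : c = a y
        · rw [hcy, vq y hy _ t1]
          have n3 := qne y hy
          have n4 := hpne y hy
          simp only [T3_eq]
          split_ifs <;> first | linarith | grind
        · rw [hp y hy c hc hcy, vp y hy _ t1]
          split_ifs <;> linarith
      linarith
    have hex := hexc x hx y hy hxy he
    have hey := hexc y hy x hx hxy.symm (by rwa [hsym])
    have hin : ∀ w, w ≠ x → w ≠ y → w ∈ Q := by
      intro w h1 h2
      by_contra h
      rcases hZ w h with h | h <;> contradiction
    have hcov : ∀ v w, v ≠ w → r v w = α ∨ r v w = p x ∨ r v w = p y ∨ r v w = r x y := by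
      intro v w hvw
      by_cases hv : v ∈ Q <;> by_cases hw : w ∈ Q
      · exact Or.inl (hQ v hv w hw hvw)
      · rw [hsym v w]
        rcases hZ w hw with rfl | rfl
        · right; left; exact hex v hv
        · right; right; left; exact hey v hv
      · rcases hZ v hv with rfl | rfl
        · right; left; exact hex w hw
        · right; right; left; exact hey w hw
      · right; right; right
        rcases hZ v hv with rfl | rfl <;> rcases hZ w hw with rfl | rfl
        · exact (hvw rfl).elim
        · rfl
        · exact hsym _ _
        · exact (hvw rfl).elim
    right
    have hppne : p x ≠ p y := by
      intro hpp
      have := card_le {α, p x, r x y} (by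
        intro v w hvw
        have := hcov v w hvw
        rw [← hpp] at this
        simp only [Finset.mem_insert, Finset.mem_singleton]
        tauto)
      have := Finset.card_le_three (a := α) (b := p x) (c := r x y)
      omega
    refine ⟨?_, x, y, hxy, α, p y, p x, r x y, ⟨(hpne y hy).symm, (hpne x hx).symm, he.symm,
      hppne.symm, ?_, ?_⟩, rfl, fun w h1 h2 => hex w (hin w h1 h2),
      fun w h1 h2 => hey w (hin w h1 h2),
      fun v w hvw h1 h2 h3 h4 => hQ v (hin v h1 h2) w (hin w h3 h4) hvw⟩
    · have := card_le {α, p x, p y, r x y} (by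
        intro v w hvw
        have := hcov v w hvw
        simp only [Finset.mem_insert, Finset.mem_singleton]
        tauto)
      have := Finset.card_le_four (a := α) (b := p x) (c := p y) (d := r x y)
      omega
    · intro h
      have h1 := hebad y hy x hx hxy.symm (by rwa [hsym])
      rw [hsym y x, ← h, vp y hy _ (tne2 _ (hpne y hy)), if_pos rfl] at h1
      linarith
    · intro h
      have h1 := hebad x hx y hy hxy he
      rw [← h, vp x hx _ (tne2 _ (hpne x hx)), if_pos rfl] at h1
      linarith

theorem five_of {X : Type*} [DecidableEq X] (P : Finset X) (hP : 5 ≤ P.card) (a b : X) :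
    ∃ c ∈ P, ∃ d ∈ P, ∃ e ∈ P, c ≠ a ∧ c ≠ b ∧ d ≠ a ∧ d ≠ b ∧ e ≠ a ∧ e ≠ b ∧
      c ≠ d ∧ c ≠ e ∧ d ≠ e := by
  obtain ⟨c, hcP, hc⟩ := ex_diff P {a, b} (lt_of_le_of_lt Finset.card_le_two (by omega))
  obtain ⟨d, hdP, hd⟩ := ex_diff P {a, b, c} (lt_of_le_of_lt Finset.card_le_three (by omega))
  obtain ⟨e, heP, he⟩ := ex_diff P {a, b, c, d} (lt_of_le_of_lt Finset.card_le_four (by omega))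
  simp only [Finset.mem_insert, Finset.mem_singleton, not_or] at hc hd he
  exact ⟨c, hcP, d, hdP, e, heP, by tauto, by tauto, by tauto, by tauto, by tauto, by tauto,
    by tauto, by tauto, by tauto⟩

theorem five_const {X : Type*} [DecidableEq X] (K : X → X → ℚ) (κ : ℚ) (P : Finset X)
    (hP : 5 ≤ P.card)
    (hK : ∀ x ∈ P, ∀ y ∈ P, ∀ z ∈ P, x ≠ y → y ≠ z → x ≠ z → K x y + K y z + K x z = κ) :
    ∀ x ∈ P, ∀ y ∈ P, x ≠ y → K x y = κ / 3 := by
  intro a ha b hb hab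
  obtain ⟨c, hc, d, hd, e, he, h1, h2, h3, h4, h5, h6, h7, h8, h9⟩ := five_of P hP a b
  have e1 := hK a ha b hb c hc hab h2.symm h1.symm
  have e2 := hK a ha b hb d hd hab h4.symm h3.symm
  have e3 := hK a ha b hb e he hab h6.symm h5.symm
  have e4 := hK a ha c hc d hd h1.symm h7 h3.symm
  have e5 := hK a ha c hc e he h1.symm h8 h5.symm
  have e6 := hK a ha d hd e he h3.symm h9 h5.symm
  have e7 := hK b hb c hc d hd h2.symm h7 h4.symm
  have e8 := hK b hb c hc e he h2.symm h8 h6.symm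
  have e9 := hK b hb d hd e he h4.symm h9 h6.symm
  have e10 := hK c hc d hd e he h7 h9 h8
  linarith

/-- integrality of six times the dual functions -/
theorem exists_int {X C : Type*} [Fintype X] [DecidableEq C] (r : X → X → C)
    (hX : 9 ≤ Fintype.card X) (t : Multiset C) (f : C → ℚ)
    (hf : ∀ x y z, x ≠ y → y ≠ z → x ≠ z → f (r x y) + f (r y z) + f (r x z) =
      if ({r x y, r y z, r x z} : Multiset C) = t then 1 else 0) :
    ∃ F : C → ℤ, ∀ x y, x ≠ y → (F (r x y) : ℚ) = 6 * f (r x y) := by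
  refine ⟨fun c => ⌊6 * f c⌋, ?_⟩
  intro a b hab
  let I : X → X → X → ℤ := fun x y z =>
    if ({r x y, r y z, r x z} : Multiset C) = t then 1 else 0
  have hI : ∀ x y z, x ≠ y → y ≠ z → x ≠ z →
      f (r x y) + f (r y z) + f (r x z) = ((I x y z : ℤ) : ℚ) := by
    intro x y z h1 h2 h3
    rw [hf x y z h1 h2 h3]
    simp [I]
  obtain ⟨c, d, e, h1, h2, h3, h4, h5, h6, h7, h8, h9⟩ := ex_three hX a b
  have e1 := hI a b c hab h2.symm h1.symm
  have e2 := hI a b d hab h4.symm h3.symm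
  have e3 := hI a b e hab h6.symm h5.symm
  have e4 := hI a c d h1.symm h7 h3.symm
  have e5 := hI a c e h1.symm h8 h5.symm
  have e6 := hI a d e h3.symm h9 h5.symm
  have e7 := hI b c d h2.symm h7 h4.symm
  have e8 := hI b c e h2.symm h8 h6.symm
  have e9 := hI b d e h4.symm h9 h6.symm
  have e10 := hI c d e h7 h9 h8
  have key : 6 * f (r a b) = ((2 * (I a b c + I a b d + I a b e) - (I a c d + I a c e + I a d e
      + I b c d + I b c e + I b d e) + 2 * I c d e : ℤ) : ℚ) := by
    push_cast
    linarith
  show ((⌊6 * f (r a b)⌋ : ℤ) : ℚ) = _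
  rw [key, Int.floor_intCast]

theorem exists_not_three {X C : Type*} [Fintype X] [DecidableEq C] (r : X → X → C)
    (hsym : ∀ x y, r x y = r y x) (hX : 9 ≤ Fintype.card X) (V : Multiset C → C → ℚ)
    (hV : ∀ t x y z, x ≠ y → y ≠ z → x ≠ z → V t (r x y) + V t (r y z) + V t (r x z) =
      if ({r x y, r y z, r x z} : Multiset C) = t then 1 else 0)
    (F : Multiset C → C → ℤ) (hF : ∀ t x y, x ≠ y → (F t (r x y) : ℚ) = 6 * V t (r x y)) :
    ∃ t x y, x ≠ y ∧ ¬ (3 : ℤ) ∣ F t (r x y) := by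
  by_contra hcon
  push Not at hcon
  let S := (finite_A3 r).toFinset
  have hz := zero_of_tri r hsym hX (fun c => ∑ t ∈ S, V t c - 1 / 3) (by
    intro x y z h1 h2 h3
    have h : ∑ t ∈ S, (V t (r x y) + V t (r y z) + V t (r x z)) = 1 := by
      rw [Finset.sum_congr rfl (fun t _ => hV t x y z h1 h2 h3)]
      rw [Finset.sum_ite_eq, if_pos]
      simp only [S, Set.Finite.mem_toFinset]
      exact ⟨x, y, z, h1, h2, h3, rfl⟩
    rw [Finset.sum_add_distrib, Finset.sum_add_distrib] at h
    show (∑ t ∈ S, V t (r x y) - 1 / 3) + (∑ t ∈ S, V t (r y z) - 1 / 3) +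
      (∑ t ∈ S, V t (r x z) - 1 / 3) = 0
    linarith)
  obtain ⟨x, y, hxy⟩ : ∃ x y : X, x ≠ y := Fintype.exists_pair_of_one_lt_card (by omega)
  have h1 := hz x y hxy
  have h2 : ((∑ t ∈ S, F t (r x y) : ℤ) : ℚ) = 2 := by
    push_cast
    rw [Finset.sum_congr rfl (fun t _ => hF t x y hxy), ← Finset.mul_sum]
    linarith
  have h3 : (∑ t ∈ S, F t (r x y) : ℤ) = 2 := by exact_mod_cast h2
  have h4 : (3 : ℤ) ∣ ∑ t ∈ S, F t (r x y) := Finset.dvd_sum (fun t _ => hcon t x y hxy)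
  rw [h3] at h4
  omega

theorem const_mod_three {X : Type*} [Fintype X] (hX : 9 ≤ Fintype.card X)
    (G : X → X → ℤ) (hs : ∀ x y, G x y = G y x)
    (hG : ∀ x y z, x ≠ y → y ≠ z → x ≠ z →
      G x y + G y z + G x z = 0 ∨ G x y + G y z + G x z = 6) :
    ∀ x y u v, x ≠ y → u ≠ v → G x y % 3 = G u v % 3 := by
  classical
  have h1 : ∀ a b c d, a ≠ b → c ≠ d → a ≠ c → a ≠ d → b ≠ c → b ≠ d →
      G a b % 3 = G c d % 3 := by
    intro a b c d hab hcd hac had hbc hbd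
    have e1 := hG a b c hab hbc hac
    have e2 := hG a b d hab hbd had
    have e3 := hG a c d hac hcd had
    have e4 := hG b c d hbc hcd hbd
    omega
  intro x y u v hxy huv
  obtain ⟨c, hc⟩ := ex_out ({x, y, u, v} : Finset X)
    (lt_of_le_of_lt Finset.card_le_four (by omega))
  obtain ⟨d, hd⟩ := ex_out ({x, y, u, v, c} : Finset X)
    (lt_of_le_of_lt Finset.card_le_five (by omega))
  simp only [Finset.mem_insert, Finset.mem_singleton, not_or] at hc hd
  have hcd : c ≠ d := by tauto
  rw [h1 x y c d hxy hcd (by tauto) (by tauto) (by tauto) (by tauto),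
    h1 u v c d huv hcd (by tauto) (by tauto) (by tauto) (by tauto)]

theorem exists_side {X : Type*} [Fintype X] [DecidableEq X] (hX : 9 ≤ Fintype.card X)
    (G : X → X → ℤ) (hs : ∀ x y, G x y = G y x)
    (hG : ∀ x y z, x ≠ y → y ≠ z → x ≠ z →
      G x y + G y z + G x z = 0 ∨ G x y + G y z + G x z = 6) :
    ∃ Y : Finset X, 5 ≤ Y.card ∧ (∀ x ∈ Y, ∀ y ∈ Y, x ≠ y → G x y % 2 = 0) ∧
      (∀ x ∈ Y, ∀ z, z ∉ Y → G x z % 2 = 1) := by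
  obtain ⟨o⟩ : Nonempty X := Fintype.card_pos_iff.1 (by omega)
  let Y : Finset X := Finset.univ.filter (fun y => y = o ∨ G o y % 2 = 0)
  have hY : ∀ y, y ∈ Y ↔ (y = o ∨ G o y % 2 = 0) := by intro y; simp [Y]
  have h1 : ∀ x ∈ Y, ∀ y ∈ Y, x ≠ y → G x y % 2 = 0 := by
    intro x hx y hy hxy
    rw [hY] at hx hy
    by_cases hxo : x = o
    · subst hxo; rcases hy with hy | hy
      · exact (hxy hy.symm).elim
      · exact hy
    by_cases hyo : y = o
    · subst hyo; rw [hs]; rcases hx with hx | hx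
      · exact (hxy hx).elim
      · exact hx
    have := hG o x y (Ne.symm hxo) hxy (Ne.symm hyo)
    simp only [hxo, hyo, false_or] at hx hy
    omega
  have h2 : ∀ x ∈ Y, ∀ z, z ∉ Y → G x z % 2 = 1 := by
    intro x hx z hz
    rw [hY] at hx hz
    push Not at hz
    by_cases hxo : x = o
    · subst hxo; omega
    have hxz : x ≠ z := by
      rintro rfl; rcases hx with h | h
      · exact hxo h
      · exact hz.2 h
    have := hG o x z (Ne.symm hxo) hxz (Ne.symm hz.1)
    simp only [hxo, false_or] at hx
    omega
  have h3 : ∀ x, x ∉ Y → ∀ z, z ∉ Y → x ≠ z → G x z % 2 = 0 := by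
    intro x hx z hz hxz
    rw [hY] at hx hz
    push Not at hx hz
    have := hG o x z (Ne.symm hx.1) hxz (Ne.symm hz.1)
    omega
  by_cases hc : 5 ≤ Y.card
  · exact ⟨Y, hc, h1, h2⟩
  · refine ⟨Yᶜ, ?_, ?_, ?_⟩
    · rw [Finset.card_compl]; omega
    · intro x hx y hy
      exact h3 x (Finset.mem_compl.1 hx) y (Finset.mem_compl.1 hy)
    · intro x hx z hz
      rw [hs]
      exact h2 z (by simpa using hz) x (Finset.mem_compl.1 hx)

theorem five_bound {X : Type*} [DecidableEq X]
    (G : X → X → ℤ)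
    (hG : ∀ x y z, x ≠ y → y ≠ z → x ≠ z →
      G x y + G y z + G x z = 0 ∨ G x y + G y z + G x z = 6)
    (Y : Finset X) (hY : 5 ≤ Y.card)
    (hev : ∀ x ∈ Y, ∀ y ∈ Y, x ≠ y → G x y % 2 = 0) (a b : X) (ha : a ∈ Y) (hb : b ∈ Y)
    (hab : a ≠ b) : -6 ≤ G a b ∧ G a b ≤ 7 := by
  obtain ⟨c, hc, d, hd, e, he, h1, h2, h3, h4, h5, h6, h7, h8, h9⟩ := five_of Y hY a b
  have hB : ∀ x y z, x ≠ y → y ≠ z → x ≠ z →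
      0 ≤ G x y + G y z + G x z ∧ G x y + G y z + G x z ≤ 6 := by
    intro x y z k1 k2 k3
    rcases hG x y z k1 k2 k3 with h | h <;> omega
  have e1 := hB a b c hab h2.symm h1.symm
  have e2 := hB a b d hab h4.symm h3.symm
  have e3 := hB a b e hab h6.symm h5.symm
  have e4 := hB a c d h1.symm h7 h3.symm
  have e5 := hB a c e h1.symm h8 h5.symm
  have e6 := hB a d e h3.symm h9 h5.symm
  have e7 := hB b c d h2.symm h7 h4.symm
  have e8 := hB b c e h2.symm h8 h6.symm
  have e9 := hB b d e h4.symm h9 h6.symm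
  have e10 := hB c d e h7 h9 h8
  have p1 := hev a ha c hc h1.symm
  have p2 := hev a ha b hb hab
  have l1 : -6 ≤ G a b := by linarith
  have l2 : G a b ≤ 8 := by linarith
  refine ⟨l1, ?_⟩
  by_contra hcon
  have l3 : G a b = 8 := by omega
  have l4 : G a c = -1 := by
    apply le_antisymm <;> linarith
  rw [l4] at p1
  omega

/-- The pentagon configuration cannot occur. -/
theorem no_exotic {X C : Type*} [Fintype X] [DecidableEq X] (r : X → X → C)
    (hsym : ∀ x y, r x y = r y x) (hX : 9 ≤ Fintype.card X)
    (hD : ∀ s : Multiset C → ℚ, ∃ f : C → ℚ, ∀ x y z, x ≠ y → y ≠ z → x ≠ z →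
      f (r x y) + f (r y z) + f (r x z) = s {r x y, r y z, r x z})
    (F : C → ℤ)
    (hG : ∀ x y z, x ≠ y → y ≠ z → x ≠ z →
      F (r x y) + F (r y z) + F (r x z) = 0 ∨ F (r x y) + F (r y z) + F (r x z) = 6)
    (h3 : ∀ x y, x ≠ y → F (r x y) % 3 = 1) : False := by
  classical
  obtain ⟨Y, hY, hev, -⟩ := exists_side hX (fun x y => F (r x y)) (fun x y => by
    show F (r x y) = F (r y x); rw [hsym]) hG
  obtain ⟨P, hPY, hP⟩ := Finset.exists_subset_card_eq hY
  have hval : ∀ x ∈ P, ∀ y ∈ P, x ≠ y → F (r x y) = -2 ∨ F (r x y) = 4 := by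
    intro x hx y hy hxy
    have h1 := five_bound (fun x y => F (r x y)) hG Y hY hev x y (hPY hx) (hPY hy) hxy
    have h2 := hev x (hPY hx) y (hPY hy) hxy
    have h3 := h3 x y hxy
    omega
  have hpm : ∀ y ∈ P, (∃ a ∈ P, ∃ b ∈ P, a ≠ y ∧ b ≠ y ∧ a ≠ b ∧
      F (r y a) = 4 ∧ F (r y b) = 4) ∧ (∃ a ∈ P, ∃ b ∈ P, a ≠ y ∧ b ≠ y ∧ a ≠ b ∧
      F (r y a) = -2 ∧ F (r y b) = -2) := by
    intro y hy
    obtain ⟨a, ha, ha'⟩ := ex_diff P {y} (by rw [Finset.card_singleton]; omega)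
    obtain ⟨b, hb, c, hc, d, hd, h1, h2, h3, h4, h5, h6, h7, h8, h9⟩ :=
      five_of P (by omega) y a
    simp only [Finset.mem_singleton] at ha'
    have t1 := hG y a b (Ne.symm ha') h2.symm h1.symm
    have t2 := hG y a c (Ne.symm ha') h4.symm h3.symm
    have t3 := hG y a d (Ne.symm ha') h6.symm h5.symm
    have t4 := hG y b c h1.symm h7 h3.symm
    have t5 := hG y b d h1.symm h8 h5.symm
    have t6 := hG y c d h3.symm h9 h5.symm
    have t7 := hG a b c h2.symm h7 h4.symm
    have t8 := hG a b d h2.symm h8 h6.symm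
    have t9 := hG a c d h4.symm h9 h6.symm
    have t10 := hG b c d h7 h9 h8
    have v1 := hval y hy a ha (Ne.symm ha')
    have v2 := hval y hy b hb h1.symm
    have v3 := hval y hy c hc h3.symm
    have v4 := hval y hy d hd h5.symm
    have v5 := hval a ha b hb h2.symm
    have v6 := hval a ha c hc h4.symm
    have v7 := hval a ha d hd h6.symm
    have v8 := hval b hb c hc h7
    have v9 := hval b hb d hd h8
    have v10 := hval c hc d hd h9
    rcases v1 with v1 | v1 <;> rcases v2 with v2 | v2 <;> rcases v3 with v3 | v3 <;>
      rcases v4 with v4 | v4 <;> first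
      | (exfalso; omega)
      | (constructor <;> first
        | exact ⟨a, ha, b, hb, ha', h1, h2.symm, v1, v2⟩
        | exact ⟨a, ha, c, hc, ha', h3, h4.symm, v1, v3⟩
        | exact ⟨a, ha, d, hd, ha', h5, h6.symm, v1, v4⟩
        | exact ⟨b, hb, c, hc, h1, h3, h7, v2, v3⟩
        | exact ⟨b, hb, d, hd, h1, h5, h8, v2, v4⟩
        | exact ⟨c, hc, d, hd, h3, h5, h9, v3, v4⟩)
  obtain ⟨z, hz⟩ := ex_out P (by omega)
  have hne : ∀ y ∈ P, y ≠ z := fun y hy h => hz (h ▸ hy)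
  have hone : ∀ y ∈ P, F (r y z) = 1 := by
    intro y hy
    obtain ⟨⟨a, ha, b, hb, h1, h2, h3, h4, h5⟩, ⟨c, hc, d, hd, k1, k2, k3, k4, k5⟩⟩ := hpm y hy
    have e1 := hG y a z h1.symm (hne a ha) (hne y hy)
    have e2 := hG y b z h2.symm (hne b hb) (hne y hy)
    have e3 := hG a b z h3 (hne b hb) (hne a ha)
    have e4 := hG y a b h1.symm h3 h2.symm
    have v1 := hval a ha b hb h3
    have g1 := hG y c z k1.symm (hne c hc) (hne y hy)
    have g2 := hG y d z k2.symm (hne d hd) (hne y hy)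
    have g3 := hG c d z k3 (hne d hd) (hne c hc)
    have g4 := hG y c d k1.symm k3 k2.symm
    have v2 := hval c hc d hd k3
    omega
  obtain ⟨f, hf⟩ := hD (fun m => if m.map F = ({4, 1, 1} : Multiset ℤ) then 1 else 0)
  simp only [Multiset.insert_eq_cons, Multiset.map_cons, Multiset.map_singleton] at hf
  simp only [← Multiset.insert_eq_cons] at hf
  have hf0 : ∀ x ∈ P, ∀ y ∈ P, x ≠ y → f (r x y) = 0 := by
    intro x hx y hy hxy
    have := five_const (fun x y => f (r x y)) 0 P (by omega) (by
      intro x hx y hy z hz h1 h2 h3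
      show f (r x y) + f (r y z) + f (r x z) = 0
      rw [hf x y z h1 h2 h3, if_neg]
      rw [T3_eq]
      have v1 := hval x hx y hy h1
      have v2 := hval y hy z hz h2
      have v3 := hval x hx z hz h3
      omega) x hx y hy hxy
    simpa using this
  have hf1 : ∀ y ∈ P, f (r y z) = 1 := by
    intro y hy
    obtain ⟨⟨a, ha, b, hb, h1, h2, h3, h4, h5⟩, -⟩ := hpm y hy
    have e4 := hG y a b h1.symm h3 h2.symm
    have v1 := hval a ha b hb h3
    have v2 : F (r a b) = -2 := by omega
    have e1 := hf y a z h1.symm (hne a ha) (hne y hy)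
    have e2 := hf y b z h2.symm (hne b hb) (hne y hy)
    have e3 := hf a b z h3 (hne b hb) (hne a ha)
    rw [hf0 y hy a ha h1.symm, h4, hone a ha, hone y hy, if_pos rfl] at e1
    rw [hf0 y hy b hb h2.symm, h5, hone b hb, hone y hy, if_pos rfl] at e2
    rw [hf0 a ha b hb h3, v2, hone b hb, hone a ha, if_neg (by rw [T3_eq]; omega)] at e3
    linarith
  obtain ⟨y, hy⟩ : P.Nonempty := Finset.card_pos.1 (by omega)
  obtain ⟨⟨a, ha, b, hb, h1, h2, h3, h4, h5⟩, -⟩ := hpm y hy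
  have e1 := hf y a z h1.symm (hne a ha) (hne y hy)
  rw [hf0 y hy a ha h1.symm, h4, hone a ha, hone y hy, if_pos rfl, hf1 a ha, hf1 y hy] at e1
  linarith

set_option maxHeartbeats 4000000 in
theorem exists_indep {X : Type*} [Fintype X] [DecidableEq X] (hX : 9 ≤ Fintype.card X)
    (G : X → X → ℤ) (hs : ∀ x y, G x y = G y x)
    (hG : ∀ x y z, x ≠ y → y ≠ z → x ≠ z →
      G x y + G y z + G x z = 0 ∨ G x y + G y z + G x z = 6)
    (h3 : ∀ x y, x ≠ y → G x y % 3 = 2) :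
    ∃ P : Finset X, 5 ≤ P.card ∧ ∀ x ∈ P, ∀ y ∈ P, x ≠ y → G x y = 2 := by
  obtain ⟨Y, hY, hev, hodd⟩ := exists_side hX G hs hG
  have hval : ∀ x ∈ Y, ∀ y ∈ Y, x ≠ y → G x y = -4 ∨ G x y = 2 := by
    intro x hx y hy hxy
    have h1 := five_bound G hG Y hY hev x y hx hy hxy
    have h2 := hev x hx y hy hxy
    have h3 := h3 x y hxy
    omega
  have hmat : ∀ x ∈ Y, ∀ y ∈ Y, ∀ z ∈ Y, x ≠ y → y ≠ z → x ≠ z → G x y = -4 → G x z = -4 →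
      False := by
    intro x hx y hy z hz h1 h2 h3 h4 h5
    have := hG x y z h1 h2 h3
    have := hval y hy z hz h2
    omega
  by_cases hZ : ∃ z, z ∉ Y
  · obtain ⟨z, hz⟩ := hZ
    have hdis : ∀ a ∈ Y, ∀ b ∈ Y, ∀ c ∈ Y, ∀ d ∈ Y, a ≠ b → a ≠ c → a ≠ d → b ≠ c → b ≠ d →
        c ≠ d → G a b = -4 → G c d = -4 → False := by
      intro a ha b hb c hc d hd hab hac had hbc hbd hcd e1 e2
      have n : ∀ y ∈ Y, y ≠ z := fun y hy h => hz (h ▸ hy)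
      have v1 := hval a ha c hc hac
      have v2 := hval a ha d hd had
      have v3 := hval b hb c hc hbc
      have v4 := hval b hb d hd hbd
      have t1 := hG a b c hab hbc hac
      have t2 := hG a b d hab hbd had
      have z1 := hG a b z hab (n b hb) (n a ha)
      have z2 := hG c d z hcd (n d hd) (n c hc)
      have z3 := hG a c z hac (n c hc) (n a ha)
      have z4 := hG a d z had (n d hd) (n a ha)
      have z5 := hG b c z hbc (n c hc) (n b hb)
      have z6 := hG b d z hbd (n d hd) (n b hb)
      have o1 := hodd a ha z hz
      have w1 : G a c = 2 := by omega
      have w2 : G a d = 2 := by omega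
      have w3 : G b c = 2 := by omega
      have w4 : G b d = 2 := by omega
      have b1 : 4 ≤ G b z + G a z := by omega
      have b2 : 4 ≤ G d z + G c z := by omega
      have b3 : G c z + G a z ≤ 4 := by omega
      have b4 : G d z + G a z ≤ 4 := by omega
      have b5 : G c z + G b z ≤ 4 := by omega
      have b6 : G d z + G b z ≤ 4 := by omega
      clear z1 z2 z3 z4 z5 z6 v1 v2 v3 v4 t1 t2
      omega
    by_cases hM : ∃ a ∈ Y, ∃ b ∈ Y, a ≠ b ∧ G a b = -4
    · obtain ⟨a, ha, b, hb, hab, hGab⟩ := hM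
      have hrest : ∀ c ∈ Y, ∀ d ∈ Y, c ≠ a → d ≠ a → c ≠ d → G c d = 2 := by
        intro c hc d hd hca hda hcd
        rcases hval c hc d hd hcd with h | h
        · exfalso
          by_cases hcb : c = b
          · subst hcb
            exact hmat c hc a ha d hd hca (Ne.symm hda) hcd (by rw [hs]; exact hGab) h
          by_cases hdb : d = b
          · subst hdb
            exact hmat d hd a ha c hc hda (Ne.symm hca) hcd.symm (by rw [hs]; exact hGab)
              (by rw [hs]; exact h)
          exact hdis a ha b hb c hc d hd hab hca.symm hda.symm (Ne.symm hcb) (Ne.symm hdb) hcd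
            hGab h
        · exact h
      have hrest' : ∀ c ∈ Y, c ≠ a → c ≠ b → G a c = 2 := by
        intro c hc hca hcb
        rcases hval a ha c hc hca.symm with h | h
        · exact (hmat a ha b hb c hc hab (Ne.symm hcb) hca.symm hGab h).elim
        · exact h
      by_cases h6 : 6 ≤ Y.card
      · refine ⟨Y.erase a, ?_, ?_⟩
        · rw [Finset.card_erase_of_mem ha]; omega
        · intro x hx y hy hxy
          rw [Finset.mem_erase] at hx hy
          exact hrest x hx.2 y hy.2 hx.1 hy.1 hxy
      · exfalso
        obtain ⟨c, hc, d, hd, e, he, h1, h2, h3', h4, h5, h6', h7, h8, h9⟩ := five_of Y hY a b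
        have hzz : ∀ w, w ∉ Y → G c w = -1 ∧ (G a w = 5 ∨ G b w = 5) := by
          intro w hw
          have n : ∀ y ∈ Y, y ≠ w := fun y hy h => hw (h ▸ hy)
          have z1 := hG a b w hab (n b hb) (n a ha)
          have z2 := hG a c w h1.symm (n c hc) (n a ha)
          have z3 := hG b c w h2.symm (n c hc) (n b hb)
          have z4 := hG c d w h7 (n d hd) (n c hc)
          have z5 := hG c e w h8 (n e he) (n c hc)
          have z6 := hG d e w h9 (n e he) (n d hd)
          have z7 := hG a d w h3'.symm (n d hd) (n a ha)
          have z8 := hG b d w h4.symm (n d hd) (n b hb)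
          rw [hGab] at z1
          rw [hrest' c hc h1 h2] at z2
          rw [hrest b hb c hc hab.symm h1 h2.symm] at z3
          rw [hrest c hc d hd h1 h3' h7] at z4
          rw [hrest c hc e he h1 h5 h8] at z5
          rw [hrest d hd e he h3' h5 h9] at z6
          rw [hrest' d hd h3' h4] at z7
          rw [hrest b hb d hd hab.symm h3' h4.symm] at z8
          have o1 := hodd a ha w hw
          have o2 := hodd b hb w hw
          have o3 := hodd c hc w hw
          have m1 := h3 a w (n a ha)
          have m2 := h3 b w (n b hb)
          have m3 := h3 c w (n c hc)
          have u1 : 4 ≤ G b w + G a w ∧ G b w + G a w ≤ 10 := by clear * - z1; omega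
          have u2 : G c w + G a w ≤ 4 ∧ -2 ≤ G c w + G a w := by clear * - z2; omega
          have u3 : G c w + G b w ≤ 4 ∧ -2 ≤ G c w + G b w := by clear * - z3; omega
          have u4 : -2 ≤ G d w + G c w := by clear * - z4; omega
          have u5 : -2 ≤ G e w + G c w := by clear * - z5; omega
          have u6 : G e w + G d w ≤ 4 := by clear * - z6; omega
          have lo : -4 ≤ G c w := by clear * - u4 u5 u6; omega
          have hi : G c w ≤ 2 := by clear * - u1 u2 u3 o3; omega
          have hcw : G c w = -1 := by clear * - lo hi o3 m3; omega
          refine ⟨hcw, ?_⟩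
          rw [hcw] at u2 u3
          clear * - u1 u2 u3 o1 o2 m1 m2
          omega
        obtain ⟨z1, k1, z2, k2, z3, k3, q1, q2, q3, q4, q5, q6, q7, q8, q9⟩ :
            ∃ z1, z1 ∉ Y ∧ ∃ z2, z2 ∉ Y ∧ ∃ z3, z3 ∉ Y ∧ z1 ≠ z2 ∧ z1 ≠ z3 ∧ z2 ≠ z3 ∧
              True ∧ True ∧ True ∧ True ∧ True ∧ True := by
          have hcard : 4 ≤ (Yᶜ).card := by rw [Finset.card_compl]; omega
          obtain ⟨z1, k1, l1⟩ := ex_diff Yᶜ ∅ (by rw [Finset.card_empty]; omega)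
          obtain ⟨z2, k2, l2⟩ := ex_diff Yᶜ {z1} (by rw [Finset.card_singleton]; omega)
          obtain ⟨z3, k3, l3⟩ := ex_diff Yᶜ {z1, z2}
            (lt_of_le_of_lt Finset.card_le_two (by omega))
          simp only [Finset.mem_insert, Finset.mem_singleton, not_or, Finset.mem_compl] at *
          exact ⟨z1, k1, z2, k2, z3, k3, Ne.symm l2, Ne.symm l3.1, Ne.symm l3.2, by tauto⟩
        have hsh : ∀ z, z ∉ Y → ∀ w, w ∉ Y → z ≠ w → ∀ y ∈ Y, G y z = 5 → G y w = 5 →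
            False := by
          intro z hz w hw hzw y hy g1 g2
          have n1 : ∀ y ∈ Y, y ≠ z := fun y hy h => hz (h ▸ hy)
          have n2 : ∀ y ∈ Y, y ≠ w := fun y hy h => hw (h ▸ hy)
          have t1 := hG y z w (n1 y hy) hzw (n2 y hy)
          have t2 := hG c z w (n1 c hc) hzw (n2 c hc)
          have t3 := (hzz z hz).1
          have t4 := (hzz w hw).1
          omega
        rcases (hzz z1 k1).2 with g1 | g1 <;> rcases (hzz z2 k2).2 with g2 | g2 <;>
          rcases (hzz z3 k3).2 with g3 | g3 <;> first
          | exact hsh z1 k1 z2 k2 q1 _ ha g1 g2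
          | exact hsh z1 k1 z2 k2 q1 _ hb g1 g2
          | exact hsh z1 k1 z3 k3 q2 _ ha g1 g3
          | exact hsh z1 k1 z3 k3 q2 _ hb g1 g3
          | exact hsh z2 k2 z3 k3 q3 _ ha g2 g3
          | exact hsh z2 k2 z3 k3 q3 _ hb g2 g3
    · push Not at hM
      refine ⟨Y, hY, fun x hx y hy hxy => ?_⟩
      rcases hval x hx y hy hxy with h | h
      · exact (hM x hx y hy hxy h).elim
      · exact h
  · push Not at hZ
    let S : Finset (Finset X) := Finset.univ.filter
      (fun I => ∀ x ∈ I, ∀ y ∈ I, x ≠ y → G x y = 2)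
    have hS : S.Nonempty := ⟨∅, by simp [S]⟩
    obtain ⟨I, hI, hmax⟩ := Finset.exists_max_image S Finset.card hS
    have hI' : ∀ x ∈ I, ∀ y ∈ I, x ≠ y → G x y = 2 := by simpa [S] using hI
    refine ⟨I, ?_, hI'⟩
    have hout : ∀ x, x ∉ I → ∃ i ∈ I, G x i = -4 := by
      intro x hx
      by_contra hcon
      push Not at hcon
      have h2 : ∀ i ∈ I, G x i = 2 := by
        intro i hi
        rcases hval x (hZ x) i (hZ i) (fun h => hx (h ▸ hi)) with h | h
        · exact (hcon i hi h).elim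
        · exact h
      have hins : insert x I ∈ S := by
        simp only [S, Finset.mem_filter, Finset.mem_univ, true_and]
        intro u hu v hv huv
        rw [Finset.mem_insert] at hu hv
        rcases hu with rfl | hu <;> rcases hv with rfl | hv
        · exact (huv rfl).elim
        · exact h2 v hv
        · rw [hs]; exact h2 u hu
        · exact hI' u hu v hv huv
      have := hmax _ hins
      rw [Finset.card_insert_of_notMem hx] at this
      omega
    choose! m hm1 hm2 using hout
    have hle : (Iᶜ).card ≤ I.card := by
      apply Finset.card_le_card_of_injOn m
      · intro x hx
        exact hm1 x (by simpa using hx)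
      · intro x hx y hy hxy
        have hx : x ∉ I := by simpa using hx
        have hy : y ∉ I := by simpa using hy
        by_contra hne
        have a1 := hm2 x hx
        have a2 := hm2 y hy
        have b1 := hm1 x hx
        rw [← hxy] at a2
        exact hmat (m x) (hZ _) x (hZ _) y (hZ _) (fun h => hx (h ▸ b1)) hne
          (fun h => hy (h ▸ b1)) (by rw [hs]; exact a1) (by rw [hs]; exact a2)
    rw [Finset.card_compl] at hle
    omega

theorem exists_clique {X C : Type*} [Fintype X] [DecidableEq X] [DecidableEq C] (r : X → X → C)
    (hsym : ∀ x y, r x y = r y x) (hX : 9 ≤ Fintype.card X)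
    (hD : ∀ s : Multiset C → ℚ, ∃ f : C → ℚ, ∀ x y z, x ≠ y → y ≠ z → x ≠ z →
      f (r x y) + f (r y z) + f (r x z) = s {r x y, r y z, r x z})
    (V : Multiset C → C → ℚ)
    (hV : ∀ t x y z, x ≠ y → y ≠ z → x ≠ z → V t (r x y) + V t (r y z) + V t (r x z) =
      if ({r x y, r y z, r x z} : Multiset C) = t then 1 else 0) :
    ∃ α, ∃ P : Finset X, 5 ≤ P.card ∧ ∀ x ∈ P, ∀ y ∈ P, x ≠ y → r x y = α := by
  have hFex := fun t => exists_int r hX t (V t) (hV t)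
  choose F hF using hFex
  obtain ⟨t, x₀, y₀, hxy₀, hnd⟩ := exists_not_three r hsym hX V hV F hF
  have hsum : ∀ x y z, x ≠ y → y ≠ z → x ≠ z →
      F t (r x y) + F t (r y z) + F t (r x z) =
        if ({r x y, r y z, r x z} : Multiset C) = t then 6 else 0 := by
    intro x y z h1 h2 h3
    have h := hV t x y z h1 h2 h3
    have e1 := hF t x y h1
    have e2 := hF t y z h2
    have e3 := hF t x z h3
    have : ((F t (r x y) + F t (r y z) + F t (r x z) : ℤ) : ℚ) =
        ((if ({r x y, r y z, r x z} : Multiset C) = t then 6 else 0 : ℤ) : ℚ) := by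
      push_cast
      split_ifs at h ⊢ <;> linarith
    exact_mod_cast this
  have hG : ∀ x y z, x ≠ y → y ≠ z → x ≠ z →
      F t (r x y) + F t (r y z) + F t (r x z) = 0 ∨
      F t (r x y) + F t (r y z) + F t (r x z) = 6 := by
    intro x y z h1 h2 h3
    rw [hsum x y z h1 h2 h3]
    split_ifs <;> simp
  have hs : ∀ x y, (fun x y => F t (r x y)) x y = (fun x y => F t (r x y)) y x := by
    intro x y; show F t (r x y) = F t (r y x); rw [hsym]
  have hc := const_mod_three hX (fun x y => F t (r x y)) hs hG
  have hmod : F t (r x₀ y₀) % 3 = 1 ∨ F t (r x₀ y₀) % 3 = 2 := by omega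
  rcases hmod with hmod | hmod
  · exact (no_exotic r hsym hX hD (F t) hG
      (fun x y hxy => (hc x y x₀ y₀ hxy hxy₀).trans hmod)).elim
  obtain ⟨P, hP, hP2⟩ := exists_indep hX (fun x y => F t (r x y)) hs hG
    (fun x y hxy => (hc x y x₀ y₀ hxy hxy₀).trans hmod)
  have htype : ∀ x ∈ P, ∀ y ∈ P, ∀ z ∈ P, x ≠ y → y ≠ z → x ≠ z →
      ({r x y, r y z, r x z} : Multiset C) = t := by
    intro x hx y hy z hz h1 h2 h3
    have h := hsum x y z h1 h2 h3
    rw [hP2 x hx y hy h1, hP2 y hy z hz h2, hP2 x hx z hz h3] at h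
    by_contra hne
    rw [if_neg hne] at h
    omega
  obtain ⟨u, hu, v, hv, huv⟩ : ∃ u ∈ P, ∃ v ∈ P, u ≠ v := Finset.one_lt_card.1 (by omega)
  have hk := five_const (fun x y => if r u v = r x y then (1 : ℚ) else 0)
    (Multiset.count (r u v) t : ℚ) P hP (by
      intro x hx y hy z hz h1 h2 h3
      rw [← htype x hx y hy z hz h1 h2 h3]
      simp only [Multiset.insert_eq_cons, Multiset.count_cons, Multiset.count_singleton]
      push_cast
      ring)
  refine ⟨r u v, P, hP, fun x hx y hy hxy => ?_⟩
  have a1 := hk u hu v hv huv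
  have a2 := hk x hx y hy hxy
  simp only [if_true] at a1 a2
  by_contra hne
  rw [if_neg (Ne.symm hne), ← a1] at a2
  norm_num at a2


/-- Theorem 1.2: if `|X| ≥ 9` and `4 ≤ a₂(r) = a₃(r)`, then the color
partition of the 2-subsets of `X` has one of the three described types; in type (iii)
moreover `a₂(r) = 4`. -/
theorem main_classification {X C : Type*} [Fintype X] (r : X → X → C)
    (hsym : ∀ x y, r x y = r y x)
    (hX : 9 ≤ Fintype.card X) (h4 : 4 ≤ a2 r) (h23 : a2 r = a3 r) :
    PartitionTypeI r ∨ PartitionTypeII r ∨ (a2 r = 4 ∧ PartitionTypeIII r) := by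
  classical
  have hD := exists_dual r hsym hX h23
  choose V hV using fun t : Multiset C => hD (fun m => if m = t then 1 else 0)
  obtain ⟨α, P, hP, hPα⟩ := exists_clique r hsym hX hD V hV
  let S : Finset (Finset X) := Finset.univ.filter
    (fun I => ∀ x ∈ I, ∀ y ∈ I, x ≠ y → r x y = α)
  have hPS : P ∈ S := by simpa [S] using hPα
  obtain ⟨Q, hQ, hmax⟩ := Finset.exists_max_image S Finset.card ⟨P, hPS⟩
  have hQ' : ∀ x ∈ Q, ∀ y ∈ Q, x ≠ y → r x y = α := by simpa [S] using hQ
  have hcard := hmax P hPS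
  refine classify_of_clique r hsym h4 V hV α Q (by omega) hQ' ?_
  intro x hx
  by_contra hcon
  push Not at hcon
  have hins : insert x Q ∈ S := by
    simp only [S, Finset.mem_filter, Finset.mem_univ, true_and]
    intro u hu v hv huv
    rw [Finset.mem_insert] at hu hv
    rcases hu with rfl | hu <;> rcases hv with rfl | hv
    · exact (huv rfl).elim
    · exact hcon v hv
    · rw [hsym]; exact hcon u hu
    · exact hQ' u hu v hv huv
  have := hmax _ hins
  rw [Finset.card_insert_of_notMem hx] at this
  omega
end

section
/- Let (X,r) be a finite colored space with |X| ≥ 9 and a_2(r) = a_3(r) = 4. Then the partition {E_α : α ∈ Im(r)} of the 2-subsets of X is of one of the following types: (i) there is a color α such that for every color β ≠ α the graph (X,E_β) is a matching, and the union of the E_β over all β ≠ α is also a matching; (ii) there are two distinct colors α,β and a partition of X into two nonempty sets Y and Z such that E_α consists of all 2-subsets contained in Y together with all 2-subsets contained in Z, for every color γ ∉ {α,β} the set E_γ is a matching consisting of edges between Y and Z, the union of the E_γ over all γ ∉ {α,β} is also a matching, and E_β consists of all remaining edges; (iii) there are distinct elements y,z ∈ X and four distinct colors α,β,γ,δ with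 E_δ = {{y,z}}, E_γ = {{y,w} : w ∈ X\{y,z}}, E_β = {{z,w} : w ∈ X\{y,z}}, and E_α equal to the set of all 2-subsets of X\{y,z}. -/
namespace CS

/-- Weights encoding the four colors; sums of three weights encode color multisets. -/
def W : List ℕ := [0, 1, 4, 16]

/-- The bit test `s`-th bit of `m`. -/
def bit (m s : ℕ) : Bool := Nat.beq (Nat.mod (Nat.shiftRight m s) 2) 1

/-- Compatibility of a color `a` (new vertex to the head vertex) with the earlier rows. -/
def ok (m a : ℕ) : List ℕ → List ℕ → Bool
  | c :: cs, b :: bs => bit m (a + c + b) && ok m a cs bs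
  | _, _ => true

/-- All admissible rows for a new vertex. -/
def newRows (m : ℕ) : List (List ℕ) → List (List ℕ)
  | [] => [[]]
  | row :: R => (newRows m R).flatMap fun t => (W.filter fun a => ok m a row t).map fun a => a :: t

/-- No extension by `n` further vertices exists. -/
def dead (m : ℕ) : ℕ → List (List ℕ) → Bool
  | 0, _ => false
  | n + 1, R => (newRows m R).all fun t => dead m n (t :: R)

/-- Does the color occur? -/
def has (C : ℕ) (R : List (List ℕ)) : Bool := R.any fun row => row.any fun a => Nat.beq a C

/-- No configuration with first edge of color `c`, color `C` among the first four vertices. -/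
def kill (m c C n : ℕ) : Bool :=
  (newRows m [[c], []]).all fun x => (newRows m [x, [c], []]).all fun u =>
    !(has C [u, x, [c], []]) || dead m n [u, x, [c], []]

/-- Transposition of two weights. -/
def swp (p : ℕ × ℕ) (n : ℕ) : ℕ := if n = p.1 then p.2 else if n = p.2 then p.1 else n

/-- The transpositions used for normalization. -/
def ps : List (ℕ × ℕ) := [(0, 1), (0, 4), (0, 16), (1, 4), (1, 16), (4, 16)]

/-- Representatives of the color multisets. -/
def trs : List (ℕ × ℕ × ℕ) :=
  [(0, 0, 0), (0, 0, 1), (0, 0, 4), (0, 0, 16), (0, 1, 1), (0, 1, 4), (0, 1, 16), (0, 4, 4),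
   (0, 4, 16), (0, 16, 16), (1, 1, 1), (1, 1, 4), (1, 1, 16), (1, 4, 4), (1, 4, 16), (1, 16, 16),
   (4, 4, 4), (4, 4, 16), (4, 16, 16), (16, 16, 16)]

/-- Code of a multiset after applying `f` to the weights. -/
def cd (f : ℕ → ℕ) (t : ℕ × ℕ × ℕ) : ℕ := f t.1 + f t.2.1 + f t.2.2

/-- Contribution of a multiset to the identity mask and to the transposed masks. -/
def contrib (t : ℕ × ℕ × ℕ) : ℕ × List ℕ :=
  (2 ^ cd id t, ps.map fun p => 2 ^ cd (swp p) t)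

/-- Entrywise addition. -/
def addL : List ℕ → List ℕ → List ℕ
  | a :: as, b :: bs => (a + b) :: addL as bs
  | _, _ => []

/-- Check a predicate on the accumulated contributions of all `k`-element sublists. -/
def allSub (P : ℕ → List ℕ → Bool) : List (ℕ × List ℕ) → ℕ → ℕ → List ℕ → Bool
  | _, 0, acc, accs => P acc accs
  | [], _ + 1, _, _ => true
  | t :: l, k + 1, acc, accs =>
      allSub P l k (acc + t.1) (addL accs t.2) && allSub P l (k + 1) acc accs

/-- Table of (mask, first color, second color, number of further vertices). -/
def table : List (ℕ × ℕ × ℕ × ℕ) := [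
  (65571, 16, 4, 1), (65603, 4, 0, 1), (131107, 4, 16, 1), (131331, 4, 1, 1), (135171, 4, 0, 1),
  (65557, 4, 1, 1), (65561, 1, 0, 1), (65617, 16, 1, 1), (131121, 16, 4, 1), (131345, 1, 4, 1),
  (131153, 16, 4, 1), (135185, 1, 4, 1), (65573, 16, 1, 1), (65797, 16, 1, 1), (65605, 4, 16, 1),
  (65577, 16, 1, 1), (65633, 16, 1, 1), (196673, 4, 0, 1), (197121, 4, 0, 1), (65801, 1, 0, 1),
  (65857, 16, 1, 1), (327937, 1, 0, 1), (65609, 4, 0, 1), (66057, 16, 1, 1), (69641, 1, 0, 1),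
  (66113, 16, 1, 1), (331777, 4, 0, 1), (17104897, 1, 0, 1), (131333, 4, 1, 1), (135173, 4, 0, 1),
  (4294967557, 1, 4, 1), (131361, 16, 4, 1), (1179681, 1, 4, 3), (131113, 4, 16, 1),
  (135201, 16, 4, 1), (131337, 4, 1, 1), (131393, 16, 4, 1), (131841, 16, 4, 1),
  (135425, 1, 4, 1), (1179713, 4, 1, 1), (135177, 4, 0, 1), (1310977, 1, 0, 1),
  (4294967561, 1, 0, 1), (4294967617, 1, 0, 1), (1310785, 0, 1, 1), (1311233, 0, 1, 1),
  (1314817, 1, 0, 1), (4294967817, 0, 1, 1), (4294971401, 1, 0, 1), (4294967873, 0, 1, 1),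
  (4295229953, 0, 1, 1), (4295233537, 4, 0, 1), (4312006657, 0, 1, 1), (281474976714761, 0, 1, 1),
  (65558, 4, 1, 1), (65586, 16, 1, 1), (65562, 4, 16, 1), (65618, 16, 4, 3), (131122, 16, 4, 1),
  (131346, 16, 4, 1), (131154, 16, 4, 3), (135186, 4, 16, 1), (65574, 16, 4, 1),
  (65798, 16, 4, 1), (65606, 4, 16, 1), (65578, 16, 4, 1), (65634, 16, 4, 1), (196866, 4, 1, 1),
  (196674, 4, 0, 1), (197122, 4, 0, 1), (200706, 4, 0, 1), (65802, 16, 4, 1), (65858, 16, 4, 1),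
  (327938, 4, 1, 1), (65610, 4, 0, 1), (66058, 16, 4, 1), (69642, 4, 0, 1), (66114, 16, 4, 1),
  (331778, 4, 0, 1), (17104898, 4, 0, 1), (131110, 4, 16, 1), (131334, 4, 1, 1),
  (135174, 4, 0, 1), (4294967558, 4, 1, 1), (131362, 16, 4, 1), (1179682, 4, 16, 1),
  (135202, 16, 4, 1), (131338, 4, 1, 1), (131394, 16, 4, 1), (131842, 16, 4, 1),
  (135426, 16, 4, 1), (1179714, 4, 1, 3), (1310978, 1, 4, 1), (4294967562, 1, 4, 1),
  (4294967618, 16, 1, 1), (1310786, 4, 0, 1), (1311234, 16, 1, 1), (4294967818, 4, 0, 1),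
  (4294971402, 4, 0, 1), (4294967874, 16, 1, 1), (4295229954, 4, 0, 1), (4295233538, 4, 0, 1),
  (4312006658, 4, 0, 1), (65588, 16, 1, 1), (65564, 4, 1, 1), (65620, 16, 1, 1),
  (196656, 4, 16, 1), (65592, 16, 1, 1), (65648, 16, 1, 1), (196688, 4, 1, 1), (197136, 1, 4, 1),
  (65816, 1, 0, 1), (65872, 16, 1, 1), (327952, 1, 0, 1), (65624, 16, 1, 1), (66072, 16, 1, 1),
  (327760, 4, 0, 1), (331792, 1, 0, 1), (131124, 16, 4, 1), (131348, 16, 4, 1), (135188, 4, 1, 1),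
  (131376, 16, 4, 1), (131128, 16, 4, 1), (131184, 16, 4, 1), (135216, 16, 4, 1),
  (131352, 16, 4, 1), (131408, 16, 4, 1), (131856, 16, 4, 1), (135440, 1, 4, 1),
  (1179728, 4, 1, 1), (135192, 4, 1, 1), (1310992, 1, 0, 1), (4294967576, 1, 0, 1),
  (4294967632, 1, 0, 1), (1310800, 0, 1, 1), (4294967832, 1, 0, 1), (4295229968, 0, 1, 1),
  (4295233552, 1, 0, 1), (65828, 16, 1, 1), (65580, 16, 1, 1), (65636, 16, 1, 1),
  (196868, 4, 1, 1), (196676, 4, 16, 1), (197124, 4, 0, 1), (200708, 4, 0, 1), (65804, 16, 1, 1),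
  (65860, 16, 1, 1), (327940, 4, 1, 1), (65612, 4, 16, 1), (66060, 16, 1, 1), (69644, 4, 0, 1),
  (66116, 16, 1, 1), (196896, 16, 4, 1), (196704, 4, 16, 1), (197152, 16, 4, 1),
  (200736, 4, 16, 1), (65832, 16, 1, 1), (65888, 16, 1, 1), (327968, 16, 4, 1), (65640, 16, 1, 1),
  (66088, 16, 1, 1), (69672, 16, 1, 1), (66144, 16, 1, 1), (331808, 16, 4, 1),
  (17104928, 16, 0, 5), (196872, 4, 1, 1), (196928, 4, 16, 1), (459008, 4, 1, 1),
  (197376, 16, 4, 1), (1245248, 4, 1, 1), (196680, 4, 0, 1), (197128, 4, 0, 1), (200712, 4, 0, 1),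
  (197184, 4, 0, 1), (200768, 4, 0, 1), (462848, 4, 0, 1), (17235968, 4, 0, 1), (201216, 4, 0, 1),
  (1376512, 1, 0, 1), (4295033152, 1, 0, 1), (65864, 16, 1, 1), (327944, 4, 1, 1),
  (66312, 16, 1, 1), (328000, 16, 0, 1), (328448, 16, 4, 1), (332032, 1, 0, 1),
  (1376768, 1, 0, 1), (1380352, 1, 0, 1), (4295033352, 1, 0, 1), (4295036936, 1, 0, 1),
  (4295033408, 0, 1, 1), (66120, 16, 1, 1), (69704, 16, 1, 1), (131364, 16, 4, 1),
  (1179684, 4, 16, 1), (1179908, 1, 4, 1), (131340, 4, 1, 1), (131396, 16, 4, 1),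
  (135428, 16, 4, 1), (1179716, 4, 1, 1), (1310788, 0, 4, 5), (131368, 16, 4, 1),
  (131424, 16, 4, 1), (131872, 16, 4, 1), (135456, 16, 4, 1), (1179688, 4, 1, 1),
  (1179744, 16, 1, 1), (3276832, 0, 1, 1), (1179912, 1, 4, 1), (1179968, 1, 4, 1),
  (1442048, 1, 4, 1), (131400, 16, 4, 1), (135432, 16, 4, 1), (135488, 16, 4, 1),
  (135936, 16, 4, 1), (1179720, 4, 0, 1), (1180168, 1, 0, 1), (1183752, 1, 4, 1),
  (1180224, 1, 0, 1)]

/-- The property checked for each possible mask. -/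
def leaf (m : ℕ) (ms : List ℕ) : Bool :=
  (ms.any fun m' => Nat.blt m' m) || (Nat.beq m 65555 || (Nat.beq m 131109 || (Nat.beq m 135248 ||
    ((W.any fun c => dead m 1 [[c], []]) ||
      table.any fun q => Nat.beq q.1 m && kill q.1 q.2.1 q.2.2.1 q.2.2.2))))

set_option maxRecDepth 100000 in
set_option maxHeartbeats 0 in
theorem big_check : allSub leaf (trs.map contrib) 4 0 [0, 0, 0, 0, 0, 0] = true := by
  decide +kernel

section Search

variable {X : Type*} (g : X → X → ℕ)

/-- Rows of the coloring on a list of vertices. -/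
def rowsOf : List X → List (List ℕ)
  | [] => []
  | v :: vs => (vs.map (g v)) :: rowsOf vs

theorem ok_of (m a : ℕ) (u v : X) (us : List X)
    (h : ∀ w ∈ us, bit m (a + g u w + g v w) = true) :
    ok m a (us.map (g u)) (us.map (g v)) = true := by
  induction us with
  | nil => rfl
  | cons w us ih =>
    simp only [List.map_cons, ok, Bool.and_eq_true]
    exact ⟨h w (by simp), ih fun w' hw' => h w' (by simp [hw'])⟩

theorem mem_newRows (m : ℕ) (hW : ∀ x y, x ≠ y → g x y ∈ W)
    (hT : ∀ x y z, x ≠ y → y ≠ z → x ≠ z → bit m (g x y + g y z + g x z) = true)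
    (v : X) (vs : List X) (hn : vs.Nodup) (hv : v ∉ vs) :
    vs.map (g v) ∈ newRows m (rowsOf g vs) := by
  induction vs with
  | nil => simp [rowsOf, newRows]
  | cons u us ih =>
    have hn' := List.nodup_cons.1 hn
    have hvu : v ≠ u := fun h => hv (by simp [h])
    have hvus : v ∉ us := fun h => hv (by simp [h])
    simp only [rowsOf, newRows, List.map_cons, List.mem_flatMap, List.mem_map, List.mem_filter]
    refine ⟨us.map (g v), ih hn'.2 hvus, g v u, ⟨hW _ _ hvu, ?_⟩, rfl⟩
    apply ok_of
    intro w hw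
    exact hT v u w hvu (fun h => hn'.1 (h ▸ hw)) (fun h => hvus (h ▸ hw))

theorem not_dead [Fintype X] (m : ℕ) (hW : ∀ x y, x ≠ y → g x y ∈ W)
    (hT : ∀ x y z, x ≠ y → y ≠ z → x ≠ z → bit m (g x y + g y z + g x z) = true)
    (n : ℕ) : ∀ (vs : List X), vs.Nodup → vs.length + n ≤ Fintype.card X →
      dead m n (rowsOf g vs) = true → False := by
  classical
  induction n with
  | zero => intro vs _ _ h; simp [dead] at h
  | succ n ih =>
    intro vs hn hc h
    obtain ⟨v, hv⟩ : ∃ v, v ∉ vs := by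
      by_contra! hall
      have h1 : (Finset.univ : Finset X) ⊆ vs.toFinset := fun x _ => by simpa using hall x
      have h2 := Finset.card_le_card h1
      have h3 := vs.toFinset_card_le
      rw [Finset.card_univ] at h2
      omega
    simp only [dead, List.all_eq_true] at h
    exact ih (v :: vs) (List.nodup_cons.2 ⟨hv, hn⟩) (by simp; omega)
      (h _ (mem_newRows g m hW hT v vs hn hv))

theorem has_rowsOf (hs : ∀ x y, g x y = g y x) (u v : X) (huv : u ≠ v) (vs : List X)
    (hu : u ∈ vs) (hv : v ∈ vs) : has (g u v) (rowsOf g vs) = true := by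
  induction vs with
  | nil => simp at hu
  | cons w ws ih =>
    simp only [has, rowsOf, List.any_cons, Bool.or_eq_true]
    rcases List.mem_cons.1 hu with rfl | hu'
    · left
      rcases List.mem_cons.1 hv with rfl | hv'
      · exact absurd rfl huv
      · rw [List.any_eq_true]
        exact ⟨g u v, List.mem_map.2 ⟨v, hv', rfl⟩, Nat.beq_refl _⟩
    · rcases List.mem_cons.1 hv with rfl | hv'
      · left
        rw [List.any_eq_true]
        exact ⟨g v u, List.mem_map.2 ⟨u, hu', rfl⟩, by rw [hs u v]; exact Nat.beq_refl _⟩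
      · right; exact ih hu' hv'

theorem not_kill [Fintype X] (m : ℕ) (hs : ∀ x y, g x y = g y x)
    (hW : ∀ x y, x ≠ y → g x y ∈ W)
    (hT : ∀ x y z, x ≠ y → y ≠ z → x ≠ z → bit m (g x y + g y z + g x z) = true)
    (n c C : ℕ) (hn : 4 + n ≤ Fintype.card X) (hc : ∃ x y, x ≠ y ∧ g x y = c)
    (hC : ∃ x y, x ≠ y ∧ g x y = C) (hk : kill m c C n = true) : False := by
  classical
  obtain ⟨x, y, hxy, rfl⟩ := hc
  obtain ⟨u, v, huv, rfl⟩ := hC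
  obtain ⟨Q, hQ, hQc⟩ := Finset.exists_superset_card_eq (s := {x, y, u, v}) (n := 4)
    Finset.card_le_four (by omega)
  have hxyQ : ({x, y} : Finset X) ⊆ Q := fun z hz => hQ (by
    simp only [Finset.mem_insert, Finset.mem_singleton] at hz ⊢; tauto)
  have h2 : (Q \ {x, y}).card = 2 := by
    rw [Finset.card_sdiff_of_subset hxyQ, Finset.card_pair hxy, hQc]
  obtain ⟨a, b, hab, hQab⟩ := Finset.card_eq_two.1 h2
  have hmem : ∀ z ∈ Q, z ∈ [a, b, x, y] := by
    intro z hz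
    by_cases h : z ∈ ({x, y} : Finset X)
    · simp only [Finset.mem_insert, Finset.mem_singleton] at h
      simp; tauto
    · have : z ∈ Q \ {x, y} := Finset.mem_sdiff.2 ⟨hz, h⟩
      rw [hQab] at this
      simp only [Finset.mem_insert, Finset.mem_singleton] at this
      simp; tauto
  have ha : a ∉ ({x, y} : Finset X) := by
    have : a ∈ Q \ {x, y} := by rw [hQab]; simp
    exact (Finset.mem_sdiff.1 this).2
  have hb : b ∉ ({x, y} : Finset X) := by
    have : b ∈ Q \ {x, y} := by rw [hQab]; simp
    exact (Finset.mem_sdiff.1 this).2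
  simp only [Finset.mem_insert, Finset.mem_singleton, not_or] at ha hb
  have n2 : [x, y].Nodup := by simp [hxy]
  have n3 : [b, x, y].Nodup := by simp [hxy, hb]
  have n4 : [a, b, x, y].Nodup := by simp [hxy, hb, ha, hab]
  have hh := has_rowsOf g hs u v huv [a, b, x, y] (hmem u (hQ (by simp)))
    (hmem v (hQ (by simp)))
  simp only [kill, List.all_eq_true] at hk
  have k1 := hk _ (mem_newRows g m hW hT b [x, y] n2 (List.nodup_cons.1 n3).1) _
    (mem_newRows g m hW hT a [b, x, y] n3 (List.nodup_cons.1 n4).1)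
  change (!(has (g u v) (rowsOf g [a, b, x, y])) || dead m n (rowsOf g [a, b, x, y])) = true at k1
  rw [hh] at k1
  exact not_dead g m hW hT n _ n4 (by simpa using hn) (by simpa using k1)

end Search

theorem addL_map (f h : ℕ × ℕ → ℕ) (l : List (ℕ × ℕ)) :
    addL (l.map f) (l.map h) = l.map fun p => f p + h p := by
  induction l with
  | nil => rfl
  | cons a l ih => simp [addL, ih]

theorem allSub_sound (P : ℕ → List ℕ → Bool) (l : List (ℕ × ℕ × ℕ)) :
    ∀ (L : List (ℕ × ℕ × ℕ)) (acc : ℕ) (f : ℕ × ℕ → ℕ), L.Sublist l →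
      allSub P (l.map contrib) L.length acc (ps.map f) = true →
      P (acc + (L.map fun t => 2 ^ cd id t).sum)
        (ps.map fun p => f p + (L.map fun t => 2 ^ cd (swp p) t).sum) = true := by
  induction l with
  | nil =>
    intro L acc f hL h
    obtain rfl := List.sublist_nil.1 hL
    simpa [allSub] using h
  | cons t l ih =>
    intro L acc f hL h
    cases hL with
    | cons _ hL' =>
      rcases L with _ | ⟨s, L⟩
      · simpa [allSub] using h
      · simp only [List.map_cons, List.length_cons, allSub, Bool.and_eq_true] at h
        exact ih (s :: L) acc f hL' h.2
    | cons_cons _ hL' =>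
      simp only [List.map_cons, List.length_cons, allSub, Bool.and_eq_true] at h
      have h1 := h.1
      simp only [contrib, addL_map] at h1
      have := ih _ _ _ hL' h1
      simpa [add_assoc] using this

theorem W_perm : ∀ a ∈ W, ∀ b ∈ W, ∀ c ∈ W, ∀ x ∈ W, ∀ y ∈ W, ∀ z ∈ W,
    a + b + c = x + y + z →
      (a = x ∧ b = y ∧ c = z) ∨ (a = x ∧ b = z ∧ c = y) ∨ (a = y ∧ b = x ∧ c = z) ∨
      (a = y ∧ b = z ∧ c = x) ∨ (a = z ∧ b = x ∧ c = y) ∨ (a = z ∧ b = y ∧ c = x) := by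
  decide +kernel

/-- The identity together with the transpositions. -/
def ps' : List (ℕ × ℕ) := (0, 0) :: ps

theorem swp_zero (n : ℕ) : swp (0, 0) n = n := by
  unfold swp; split_ifs <;> simp_all

theorem swp_mem : ∀ p ∈ ps', ∀ a ∈ W, swp p a ∈ W := by decide +kernel

theorem swp_swp : ∀ p ∈ ps', ∀ a ∈ W, swp p (swp p a) = a := by decide +kernel

theorem exists_tr : ∀ p ∈ ps', ∀ a ∈ W, ∀ b ∈ W, ∀ c ∈ W, ∃ t ∈ trs,
    cd id t = a + b + c ∧ cd (swp p) t = swp p a + swp p b + swp p c := by decide +kernel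

theorem tr_swp : ∀ p ∈ ps', ∀ t ∈ trs, ∀ a ∈ W, ∀ b ∈ W, ∀ c ∈ W,
    cd id t = a + b + c → cd (swp p) t = swp p a + swp p b + swp p c := by decide +kernel

theorem nodup_tr : ∀ p ∈ ps', (trs.map (cd (swp p))).Nodup := by decide +kernel

set_option linter.unusedSectionVars false

section Main

variable {X C : Type*} [Fintype X] (r : X → X → C)

/-- The triangle codes of an encoded coloring. -/
def K (e : C → ℕ) : Set ℕ :=
  {s | ∃ x y z : X, x ≠ y ∧ y ≠ z ∧ x ≠ z ∧ s = e (r x y) + e (r y z) + e (r x z)}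

/-- A valid encoding of the colors by weights. -/
structure Enc (e : C → ℕ) : Prop where
  inj : ∀ x ∈ colorIm r, ∀ y ∈ colorIm r, e x = e y → x = y
  mem : ∀ x ∈ colorIm r, e x ∈ W
  surj : ∀ w ∈ W, ∃ x y : X, x ≠ y ∧ e (r x y) = w

variable {r}

theorem Enc.memW {e : C → ℕ} (he : Enc r e) {x y : X} (h : x ≠ y) : e (r x y) ∈ W :=
  he.mem _ ⟨x, y, h, rfl⟩

theorem Enc.inj' {e : C → ℕ} (he : Enc r e) {x y u v : X} (h : x ≠ y) (h' : u ≠ v)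
    (hh : e (r x y) = e (r u v)) : r x y = r u v :=
  he.inj _ ⟨x, y, h, rfl⟩ _ ⟨u, v, h', rfl⟩ hh

theorem Enc.swap {e : C → ℕ} (he : Enc r e) {p : ℕ × ℕ} (hp : p ∈ ps') :
    Enc r (fun c => swp p (e c)) where
  inj x hx y hy h := he.inj x hx y hy (by
    rw [← swp_swp p hp _ (he.mem x hx), ← swp_swp p hp _ (he.mem y hy)]; exact congrArg _ h)
  mem x hx := swp_mem p hp _ (he.mem x hx)
  surj w hw := by
    obtain ⟨x, y, hxy, h⟩ := he.surj _ (swp_mem p hp w hw)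
    exact ⟨x, y, hxy, by simp only [h]; exact swp_swp p hp w hw⟩

theorem Enc.K_ncard {e : C → ℕ} (he : Enc r e) : (K r e).ncard = (A3 r).ncard := by
  have himg : K r e = (fun m : Multiset C => (m.map e).sum) '' A3 r := by
    ext s
    constructor
    · rintro ⟨x, y, z, h1, h2, h3, rfl⟩
      exact ⟨_, ⟨x, y, z, h1, h2, h3, rfl⟩, by simp [add_assoc]⟩
    · rintro ⟨_, ⟨x, y, z, h1, h2, h3, rfl⟩, rfl⟩
      exact ⟨x, y, z, h1, h2, h3, by simp [add_assoc]⟩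
  rw [himg]
  apply Set.InjOn.ncard_image
  rintro _ ⟨x, y, z, h1, h2, h3, rfl⟩ _ ⟨x', y', z', h1', h2', h3', rfl⟩ h
  have h' : e (r x y) + e (r y z) + e (r x z) = e (r x' y') + e (r y' z') + e (r x' z') := by
    simpa [add_assoc] using h
  have c12 : ∀ a b c : C, ({a, b, c} : Multiset C) = {b, a, c} := fun a b c =>
    Multiset.cons_swap a b {c}
  have c23 : ∀ a b c : C, ({a, b, c} : Multiset C) = {a, c, b} := fun a b c =>
    congrArg (Multiset.cons a) (Multiset.cons_swap b c 0)
  rcases W_perm _ (he.memW h1) _ (he.memW h2) _ (he.memW h3) _ (he.memW h1') _ (he.memW h2') _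
    (he.memW h3') h' with h | h | h | h | h | h
  · rw [he.inj' h1 h1' h.1, he.inj' h2 h2' h.2.1, he.inj' h3 h3' h.2.2]
  · rw [he.inj' h1 h1' h.1, he.inj' h2 h3' h.2.1, he.inj' h3 h2' h.2.2, c23]
  · rw [he.inj' h1 h2' h.1, he.inj' h2 h1' h.2.1, he.inj' h3 h3' h.2.2, c12]
  · rw [he.inj' h1 h2' h.1, he.inj' h2 h3' h.2.1, he.inj' h3 h1' h.2.2, c23, c12]
  · rw [he.inj' h1 h3' h.1, he.inj' h2 h1' h.2.1, he.inj' h3 h2' h.2.2, c12, c23]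
  · rw [he.inj' h1 h3' h.1, he.inj' h2 h2' h.2.1, he.inj' h3 h1' h.2.2, c12, c23, c12]

open Classical in
/-- The list of occurring color multisets. -/
noncomputable def occ (r : X → X → C) (e : C → ℕ) : List (ℕ × ℕ × ℕ) :=
  trs.filter fun t => cd id t ∈ K r e

theorem Enc.mem_map_occ {e : C → ℕ} (he : Enc r e) {p : ℕ × ℕ} (hp : p ∈ ps') (s : ℕ) :
    s ∈ (occ r e).map (cd (swp p)) ↔ s ∈ K r (fun c => swp p (e c)) := by
  simp only [occ, List.mem_map, List.mem_filter, decide_eq_true_eq]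
  constructor
  · rintro ⟨t, ⟨ht, x, y, z, h1, h2, h3, h⟩, rfl⟩
    exact ⟨x, y, z, h1, h2, h3, tr_swp p hp t ht _ (he.memW h1) _ (he.memW h2) _ (he.memW h3) h⟩
  · rintro ⟨x, y, z, h1, h2, h3, rfl⟩
    obtain ⟨t, ht, h, h'⟩ := exists_tr p hp _ (he.memW h1) _ (he.memW h2) _ (he.memW h3)
    exact ⟨t, ⟨ht, x, y, z, h1, h2, h3, h⟩, h'⟩

theorem occ_nodup (e : C → ℕ) {p : ℕ × ℕ} (hp : p ∈ ps') :
    ((occ r e).map (cd (swp p))).Nodup :=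
  (nodup_tr p hp).sublist ((List.filter_sublist).map _)

theorem K_finite (e : C → ℕ) : (K r e).Finite := by
  refine (Set.finite_range fun q : X × X × X => 
    e (r q.1 q.2.1) + e (r q.2.1 q.2.2) + e (r q.1 q.2.2)).subset ?_
  rintro _ ⟨x, y, z, -, -, -, rfl⟩
  exact ⟨(x, y, z), rfl⟩

/-- The mask of an encoded coloring. -/
noncomputable def mask (r : X → X → C) (e : C → ℕ) : ℕ :=
  ∑ s ∈ (K_finite (r := r) e).toFinset, 2 ^ s

theorem Enc.toFinset_occ {e : C → ℕ} (he : Enc r e) {p : ℕ × ℕ} (hp : p ∈ ps') :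
    ((occ r e).map (cd (swp p))).toFinset =
      (K_finite (r := r) (fun c => swp p (e c))).toFinset := by
  ext s
  rw [List.mem_toFinset, he.mem_map_occ hp, Set.Finite.mem_toFinset]

theorem Enc.sum_occ {e : C → ℕ} (he : Enc r e) {p : ℕ × ℕ} (hp : p ∈ ps') :
    ((occ r e).map fun t => 2 ^ cd (swp p) t).sum = mask r (fun c => swp p (e c)) := by
  rw [mask, ← he.toFinset_occ hp, List.sum_toFinset _ (occ_nodup e hp), List.map_map]
  rfl

theorem swp_id : swp (0, 0) = id := funext swp_zero

theorem Enc.length_occ {e : C → ℕ} (he : Enc r e) : (occ r e).length = (A3 r).ncard := by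
  have hp : ((0, 0) : ℕ × ℕ) ∈ ps' := by simp [ps']
  rw [← he.K_ncard, ← List.length_map (f := cd (swp (0, 0))),
    ← List.toFinset_card_of_nodup (occ_nodup e hp), he.toFinset_occ hp]
  simp only [swp_zero]
  rw [Set.ncard_eq_toFinset_card _ (K_finite e)]

theorem bit_mask (e : C → ℕ) (s : ℕ) (hs : s ∈ K r e) : bit (mask r e) s = true := by
  have h : s ∈ (mask r e).bitIndices := by
    rw [← List.mem_toFinset, mask, Finset.toFinset_bitIndices_sum_two_pow]
    simpa using hs
  have h2 : (mask r e).testBit s = true := by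
    simpa using h
  rw [Nat.testBit_eq_decide_div_mod_eq] at h2
  have h3 : mask r e / 2 ^ s % 2 = 1 := by simpa using h2
  rw [bit, Nat.beq_eq]
  rw [← h3, ← Nat.shiftRight_eq_div_pow]
  rfl

/-- Types of normalized colorings. -/
theorem good_cases (hsym : ∀ x y, r x y = r y x) (hX : 9 ≤ Fintype.card X)
    (h3 : (A3 r).ncard = 4) : ∀ (n : ℕ) (e : C → ℕ), Enc r e → mask r e = n →
    ∃ e, Enc r e ∧ (mask r e = 65555 ∨ mask r e = 131109 ∨ mask r e = 135248) := by
  intro n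
  induction n using Nat.strong_induction_on with
  | _ n ih =>
  intro e he hm
  have hW : ∀ x y, x ≠ y → (fun x y => e (r x y)) x y ∈ W := fun x y h => he.memW h
  have hT : ∀ x y z, x ≠ y → y ≠ z → x ≠ z → bit (mask r e)
      ((fun x y => e (r x y)) x y + (fun x y => e (r x y)) y z + (fun x y => e (r x y)) x z)
      = true := fun x y z h1 h2 h3 => bit_mask e _ ⟨x, y, z, h1, h2, h3, rfl⟩
  have hs : ∀ x y, (fun x y => e (r x y)) x y = (fun x y => e (r x y)) y x := fun x y => by
    simp only [hsym x y]
  have hbig := big_check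
  have h0 : ([0, 0, 0, 0, 0, 0] : List ℕ) = ps.map fun _ => 0 := rfl
  rw [h0, ← h3, ← he.length_occ] at hbig
  have hl := allSub_sound leaf trs (occ r e) 0 _ (List.filter_sublist) hbig
  have hmask : ((occ r e).map fun t => 2 ^ cd id t).sum = mask r e := by
    have := he.sum_occ (p := (0, 0)) (by simp [ps'])
    simpa only [swp_zero, swp_id] using this
  rw [zero_add, hmask] at hl
  simp only [leaf, Bool.or_eq_true, List.any_eq_true, Nat.beq_eq, Bool.and_eq_true] at hl
  rcases hl with ⟨m', hm', hlt⟩ | h | h | h | ⟨c, hc, hd⟩ | ⟨q, hq, hqm, hk⟩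
  · obtain ⟨p, hp, rfl⟩ := List.mem_map.1 hm'
    have hp' : p ∈ ps' := List.mem_cons_of_mem _ hp
    rw [zero_add, he.sum_occ hp'] at hlt
    have hlt' : mask r (fun c => swp p (e c)) < mask r e := by simpa [Nat.blt_eq] using hlt
    exact ih _ (hm ▸ hlt') _ (he.swap hp') rfl
  · exact ⟨e, he, Or.inl h⟩
  · exact ⟨e, he, Or.inr (Or.inl h)⟩
  · exact ⟨e, he, Or.inr (Or.inr h)⟩
  · obtain ⟨x, y, hxy, rfl⟩ := he.surj c hc
    exact (not_dead (fun x y => e (r x y)) _ hW hT 1 [x, y] (by simp [hxy]) (by simp; omega)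
      hd).elim
  · rw [hqm] at hk
    have hq' : ∀ q ∈ table, q.2.1 ∈ W ∧ q.2.2.1 ∈ W ∧ q.2.2.2 ≤ 5 := by decide +kernel
    obtain ⟨a1, a2, a3⟩ := hq' q hq
    exact (not_kill (fun x y => e (r x y)) _ hs hW hT _ _ _ (by omega) (he.surj _ a1)
      (he.surj _ a2) hk).elim

theorem exists_enc (h2 : (colorIm r).ncard = 4) : ∃ e, Enc r e := by
  classical
  have hfin : (colorIm r).Finite := Set.finite_of_ncard_ne_zero (by omega)
  have hfin' : Finite (colorIm r) := hfin
  have hc : Nat.card (colorIm r) = Nat.card (Fin 4) := by simpa using h2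
  have φ : colorIm r ≃ Fin 4 := (Finite.card_eq.1 hc).some
  let w : Fin 4 → ℕ := ![0, 1, 4, 16]
  have hwi : Function.Injective w := by decide
  have hwm : ∀ i, w i ∈ W := by decide
  have hws : ∀ a ∈ W, ∃ i, w i = a := by decide
  refine ⟨fun c => if h : c ∈ colorIm r then w (φ ⟨c, h⟩) else 0, ?_, ?_, ?_⟩
  · intro x hx y hy h
    simp only [hx, hy, dif_pos] at h
    have := φ.injective (hwi h)
    simpa using this
  · intro x hx
    simp only [hx, dif_pos]
    exact hwm _
  · intro a ha
    obtain ⟨i, rfl⟩ := hws a ha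
    obtain ⟨x, y, hxy, h⟩ := (φ.symm i).2
    refine ⟨x, y, hxy, ?_⟩
    have h4 : r x y ∈ colorIm r := ⟨x, y, hxy, rfl⟩
    simp only [h4, dif_pos]
    have : (⟨r x y, h4⟩ : colorIm r) = φ.symm i := Subtype.ext h
    rw [this]; simp

theorem type_one {e : C → ℕ} (he : Enc r e) (hm : mask r e = 65555) : PartitionTypeI r := by
  have key : ∀ a ∈ W, ∀ b ∈ W, ∀ c ∈ W, bit 65555 (a + c + b) = true → a = 0 ∨ b = 0 := by
    decide +kernel
  obtain ⟨x, y, hxy, h0⟩ := he.surj 0 (by simp [W])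
  have main : IsMatchingOn r (colorIm r \ {r x y}) := by
    intro u v w hv hw h1 h2
    by_contra hvw
    have hb := bit_mask (r := r) e _ ⟨u, v, w, hv.symm, hvw, hw.symm, rfl⟩
    rw [hm] at hb
    rcases key _ (he.memW hv.symm) _ (he.memW hw.symm) _ (he.memW hvw) hb with h | h
    · exact h1.2 (he.inj' hv.symm hxy (h.trans h0.symm))
    · exact h2.2 (he.inj' hw.symm hxy (h.trans h0.symm))
  refine ⟨r x y, ⟨x, y, hxy, rfl⟩, ?_, main⟩
  intro β hβ hne u v w hv hw h1 h2
  rw [Set.mem_singleton_iff] at h1 h2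
  exact main u v w hv hw ⟨h1 ▸ hβ, fun h => hne (h1.symm.trans h)⟩
    ⟨h2 ▸ hβ, fun h => hne (h2.symm.trans h)⟩

theorem type_two (hsym : ∀ x y, r x y = r y x) {e : C → ℕ} (he : Enc r e)
    (hm : mask r e = 131109) : PartitionTypeII r := by
  classical
  have key1 : ∀ a ∈ W, ∀ b ∈ W, ∀ c ∈ W, bit 131109 (a + c + b) = true → a = 0 → 
    (b = 0 ↔ c = 0) := by
    decide +kernel
  have key2 : ∀ a ∈ W, ∀ b ∈ W, ∀ c ∈ W, bit 131109 (a + c + b) = true → a ≠ 0 → b ≠ 0 →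
    c = 0 ∧ (a = 1 ∨ b = 1) := by
    decide +kernel
  obtain ⟨a0, a1, ha, h0⟩ := he.surj 0 (by simp [W])
  obtain ⟨x0, x1, hx, h1⟩ := he.surj 1 (by simp [W])
  have tri : ∀ {x y z}, x ≠ y → y ≠ z → x ≠ z →
      bit 131109 (e (r x y) + e (r y z) + e (r x z)) = true := by
    intro x y z p q s
    rw [← hm]; exact bit_mask e _ ⟨x, y, z, p, q, s, rfl⟩
  have hα : ∀ {x y}, x ≠ y → (r x y = r a0 a1 ↔ e (r x y) = 0) := fun {x y} h =>
    ⟨fun h' => by rw [h', h0], fun h' => he.inj' h ha (h'.trans h0.symm)⟩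
  have hβ : ∀ {x y}, x ≠ y → (r x y = r x0 x1 ↔ e (r x y) = 1) := fun {x y} h =>
    ⟨fun h' => by rw [h', h1], fun h' => he.inj' h hx (h'.trans h1.symm)⟩
  let Y : Set X := {x | x = x0 ∨ e (r x0 x) = 0}
  have hiff : ∀ x y : X, x ≠ y → (r x y = r a0 a1 ↔ (x ∈ Y ∧ y ∈ Y) ∨ (x ∈ Yᶜ ∧ y ∈ Yᶜ)) := by
    intro x y hxy
    rw [hα hxy]
    simp only [Y, Set.mem_compl_iff, Set.mem_ofPred_eq]
    by_cases hx' : x0 = x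
    · subst hx'
      simp [hxy.symm]
    by_cases hy' : x0 = y
    · subst hy'
      simp [hxy, hsym x x0]
    have t := tri hx' hxy hy'
    have k1 := key1 _ (he.memW hx') _ (he.memW hy') _ (he.memW hxy) t
    have k2 := key2 _ (he.memW hx') _ (he.memW hy') _ (he.memW hxy) t
    have k3 := key1 _ (he.memW hy') _ (he.memW hx') _ (he.memW hxy) (by
      rw [← t]; congr 1; ring)
    have e1 : ¬ x = x0 := fun h => hx' h.symm
    have e2 : ¬ y = x0 := fun h => hy' h.symm
    simp only [e1, e2, false_or]
    tauto
  have hcross : ∀ x y : X, x ≠ y → r x y ≠ r a0 a1 → (x ∈ Y ∧ y ∈ Yᶜ) ∨ (x ∈ Yᶜ ∧ y ∈ Y) := by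
    intro x y hxy h
    rw [Ne, hiff x y hxy] at h
    simp only [Set.mem_compl_iff] at h ⊢
    by_cases hx1 : x ∈ Y <;> by_cases hy1 : y ∈ Y <;> simp_all
  have main : IsMatchingOn r (colorIm r \ {r a0 a1, r x0 x1}) := by
    intro u v w hv hw q1 q2
    by_contra hvw
    have m1 := q1.2
    have m2 := q2.2
    simp only [Set.mem_insert_iff, Set.mem_singleton_iff, not_or, hα hv.symm, hβ hv.symm,
      hα hw.symm, hβ hw.symm] at m1 m2
    have := (key2 _ (he.memW hv.symm) _ (he.memW hw.symm) _ (he.memW hvw)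
      (tri hv.symm hvw hw.symm) m1.1 m2.1).2
    tauto
  have hne : r a0 a1 ≠ r x0 x1 := by
    intro h
    rw [h, h1] at h0
    omega
  refine ⟨r a0 a1, ⟨a0, a1, ha, rfl⟩, r x0 x1, ⟨x0, x1, hx, rfl⟩, hne, Y, Yᶜ, ⟨x0, Or.inl rfl⟩,
    ⟨x1, ?_⟩, disjoint_compl_right, Set.union_compl_self Y, hiff, ?_, main, ?_⟩
  · rintro (h | h)
    · exact hx h.symm
    · omega
  · intro γ hγ g1 g2
    refine ⟨fun x y hxy h => hcross x y hxy (by rw [h]; exact g1), ?_⟩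
    intro u v w hv hw q1 q2
    rw [Set.mem_singleton_iff] at q1 q2
    refine main u v w hv hw ?_ ?_
    · rw [q1]; exact ⟨hγ, by simp [g1, g2]⟩
    · rw [q2]; exact ⟨hγ, by simp [g1, g2]⟩
  · intro x y hxy h
    exact hcross x y hxy (by rw [h]; exact hne.symm)

theorem type_three (hX : 9 ≤ Fintype.card X) {e : C → ℕ}
    (he : Enc r e) (hm : mask r e = 135248) : PartitionTypeIII r := by
  classical
  have key1 : ∀ a ∈ W, ∀ b ∈ W, ∀ c ∈ W, bit 135248 (a + c + b) = true → a = 16 → 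
    (b = 0 ∧ c = 1) ∨ (b = 1 ∧ c = 0) := by
    decide +kernel
  have key2 : ∀ a ∈ W, ∀ b ∈ W, ∀ c ∈ W, bit 135248 (a + c + b) = true →
    (a = 0 ∨ a = 1) → (b = 0 ∨ b = 1) → (a = b ∧ c = 4) ∨ (a ≠ b ∧ c = 16) := by
    decide +kernel
  obtain ⟨y, z, hyz, h16⟩ := he.surj 16 (by simp [W])
  have tri : ∀ {x y z}, x ≠ y → y ≠ z → x ≠ z →
      bit 135248 (e (r x y) + e (r y z) + e (r x z)) = true := by
    intro x y z p q s
    rw [← hm]; exact bit_mask e _ ⟨x, y, z, p, q, s, rfl⟩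
  have fresh : ∀ s : Finset X, s.card ≤ 4 → ∃ w, w ∉ s := by
    intro s hs
    by_contra! h
    have := Finset.card_le_card (fun x _ => h x : (Finset.univ : Finset X) ⊆ s)
    rw [Finset.card_univ] at this
    omega
  have A : ∀ w, w ≠ y → w ≠ z →
      (e (r y w) = 0 ∧ e (r z w) = 1) ∨ (e (r y w) = 1 ∧ e (r z w) = 0) := fun w h1 h2 =>
    key1 _ (he.memW hyz) _ (he.memW h1.symm) _ (he.memW h2.symm)
      (tri hyz h2.symm h1.symm) h16
  have A' : ∀ w, w ≠ y → w ≠ z → (e (r y w) = 0 ∨ e (r y w) = 1) := fun w h1 h2 => by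
    have := A w h1 h2; tauto
  have B : ∀ u v, u ≠ v → u ≠ y → u ≠ z → v ≠ y → v ≠ z →
      (e (r y u) = e (r y v) ∧ e (r u v) = 4) ∨ (e (r y u) ≠ e (r y v) ∧ e (r u v) = 16) :=
    fun u v h uy uz vy vz => key2 _ (he.memW uy.symm) _ (he.memW vy.symm) _ (he.memW h)
      (tri uy.symm h vy.symm) (A' u uy uz) (A' v vy vz)
  have S : ∀ u v, u ≠ y → u ≠ z → v ≠ y → v ≠ z → e (r y u) = e (r y v) := by
    intro u v uy uz vy vz
    by_contra hne
    have huv : u ≠ v := fun h => hne (by rw [h])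
    obtain ⟨w, hw⟩ := fresh {y, z, u, v} Finset.card_le_four
    simp only [Finset.mem_insert, Finset.mem_singleton, not_or] at hw
    obtain ⟨wy, wz, wu, wv⟩ := hw
    have b1 := B u v huv uy uz vy vz
    have b2 := B u w (Ne.symm wu) uy uz wy wz
    have b3 := B v w (Ne.symm wv) vy vz wy wz
    have a1 := A' u uy uz
    have a2 := A' v vy vz
    have a3 := A' w wy wz
    have k := key1 _ (he.memW huv) _ (he.memW (Ne.symm wu)) _ (he.memW (Ne.symm wv))
      (tri huv (Ne.symm wv) (Ne.symm wu))
    omega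
  obtain ⟨w0, hw0⟩ := fresh {y, z} (Finset.card_le_two.trans (by norm_num))
  simp only [Finset.mem_insert, Finset.mem_singleton, not_or] at hw0
  obtain ⟨w1, hw1⟩ := fresh {y, z, w0} (Finset.card_le_three.trans (by norm_num))
  simp only [Finset.mem_insert, Finset.mem_singleton, not_or] at hw1
  obtain ⟨wy, wz⟩ := hw0
  obtain ⟨vy, vz, vw⟩ := hw1
  have F : ∀ u v, u ≠ v → u ≠ y → u ≠ z → v ≠ y → v ≠ z → e (r u v) = 4 := by
    intro u v h uy uz vy vz
    have := B u v h uy uz vy vz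
    have := S u v uy uz vy vz
    tauto
  have f0 := F w0 w1 (Ne.symm vw) wy wz vy vz
  have a0 := A w0 wy wz
  have ne_of : ∀ {c d : C}, e c ≠ e d → c ≠ d := fun h h' => h (by rw [h'])
  refine ⟨y, z, hyz, r w0 w1, r z w0, r y w0, r y z,
    ⟨ne_of ?_, ne_of ?_, ne_of ?_, ne_of ?_, ne_of ?_, ne_of ?_⟩, rfl, ?_, ?_, ?_⟩
  any_goals omega
  · intro w h1 h2
    exact he.inj' h1.symm (Ne.symm wy) (S w w0 h1 h2 wy wz)
  · intro w h1 h2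
    refine he.inj' h2.symm (Ne.symm wz) ?_
    have := S w w0 h1 h2 wy wz
    have := A w h1 h2
    omega
  · intro u v h uy uz vy' vz'
    exact he.inj' h (Ne.symm vw) ((F u v h uy uz vy' vz').trans f0.symm)

end Main

end CS

/-- Theorem 3.8: if `|X| ≥ 9` and `a₂(r) = a₃(r) = 4`, then the color
partition of the 2-subsets of `X` has one of the three described types. -/
theorem classification_a2_eq_four {X C : Type*} [Fintype X] (r : X → X → C)
    (hsym : ∀ x y, r x y = r y x)
    (hX : 9 ≤ Fintype.card X) (ha2 : a2 r = 4) (ha3 : a3 r = 4) :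
    PartitionTypeI r ∨ PartitionTypeII r ∨ PartitionTypeIII r := by
  obtain ⟨e₀, he₀⟩ := CS.exists_enc (r := r) ha2
  obtain ⟨e, he, h | h | h⟩ := CS.good_cases hsym hX ha3 _ e₀ he₀ rfl
  · exact Or.inl (CS.type_one he h)
  · exact Or.inr (Or.inl (CS.type_two hsym he h))
  · exact Or.inr (Or.inr (CS.type_three hX he h))
end
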